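/- (Extension to truncated Sobolev functions, Euclidean version.) Let ·* be a transformation of Borel subsets of ℝ^n inducing a transformation of functions acting on level sets, and let φ, ψ : ℝ^n × ℝ^n → [0, +∞] satisfy the hypotheses of the sufficient condition for the Pólya–Szegő inequality (φ, ψ Borel, vanishing at ξ = 0, ψ locally coercive and convex lower semicontinuous in ξ, and capa_{ψ,λ}(A*, B*) ≤ capa_{φ,λ}(A, B) for all Borel A ⊆ B ⊆ ℝ^n and λ > 0). Suppose moreover that for every K ≥ 0, the truncation u_K = max(min(u, K), −K) of u at level K satisfies u_K* ∈ L¹_loc(ℝ^n). If u ∈ T^{1,1}_loc(ℝ^n) and ∫_{ℝ^n} φ(x, du(x)) dx < ∞, then u* ∈ T^{1,1}_loc(ℝ^n) and ∫_{ℝ^n} ψ(y, du*(y)) dy ≤ ∫_{ℝ^n} φ(x, du(x)) dx. -/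

import Mathlib

open MeasureTheory Set Filter Topology ENNReal

noncomputable section

abbrev En (n : ℕ) := EuclideanSpace ℝ (Fin n)

/-- `Du` is the weak gradient of `u` on `ℝⁿ`. -/
def HasWeakGradient {n : ℕ} (u : En n → ℝ) (Du : En n → En n) : Prop :=
  LocallyIntegrable u volume ∧ LocallyIntegrable Du volume ∧
    ∀ φ : En n → ℝ, ContDiff ℝ (⊤ : ℕ∞) φ → HasCompactSupport φ → ∀ i : Fin n,
      ∫ x, u x * fderiv ℝ φ x (EuclideanSpace.single i 1) = - ∫ x, Du x i * φ x

/-- The capacity `capa_{Φ,λ}(A,B)` associated to the integrand `Φ` and the level `λ`. -/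
def capaGen {n : ℕ} (Φ : En n → En n → ℝ≥0∞) (lam : ℝ) (A B : Set (En n)) : ℝ≥0∞ :=
  ⨅ (u : En n → ℝ) (Du : En n → En n) (_ : HasWeakGradient u Du)
    (_ : ∀ x ∈ A, u x = lam) (_ : ∀ x ∉ B, u x = 0), ∫⁻ x, Φ x (Du x)

/-- `Ψ` is locally coercive: `ψ(x,ξ)/‖ξ‖` tends to `∞` uniformly for `x` in a compact set. -/
def LocallyCoercive {n : ℕ} (Ψ : En n → En n → ℝ≥0∞) : Prop :=
  ∀ K : Set (En n), IsCompact K → ∀ C : ℝ, ∃ r : ℝ, ∀ x ∈ K, ∀ ξ : En n,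
    r ≤ ‖ξ‖ → ENNReal.ofReal (C * ‖ξ‖) ≤ Ψ x ξ

/-- A transformation of Borel sets of `ℝⁿ` inducing a transformation of Borel functions acting
on level sets. -/
structure SetRearrangement (n : ℕ) where
  setMap : Set (En n) → Set (En n)
  fnMap : (En n → EReal) → En n → EReal
  measurableSet_setMap : ∀ A : Set (En n), MeasurableSet A → MeasurableSet (setMap A)
  setMap_empty : setMap ∅ = ∅
  setMap_univ : setMap univ = univ
  measurable_fnMap : ∀ u : En n → EReal, Measurable u → Measurable (fnMap u)
  levelSet_fnMap : ∀ u : En n → EReal, Measurable u → ∀ t : ℝ,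
    {y | (t : EReal) < fnMap u y} = setMap {x | (t : EReal) < u x}

/-- The truncation of `u` at level `K`. -/
def trunc {n : ℕ} (u : En n → ℝ) (K : ℝ) : En n → ℝ := fun x => max (min (u x) K) (-K)

/-- `D` is the weak gradient of `u` in the sense of the truncated Sobolev space
`T^{1,1}_loc(ℝⁿ)`: each truncation of `u` is weakly differentiable, with weak gradient agreeing
a.e. with `D` where `|u| ≤ K`. -/
def IsTruncGradient {n : ℕ} (u : En n → ℝ) (D : En n → En n) : Prop :=
  ∀ K : ℝ, 0 ≤ K → ∃ DK : En n → En n, HasWeakGradient (trunc u K) DK ∧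
    ∀ᵐ x ∂volume, |u x| ≤ K → DK x = D x

section
open scoped Convolution

/-- A sequence of bump functions on `ℝⁿ` with support shrinking to the origin. -/
def shrinkingBump (n k : ℕ) : ContDiffBump (0 : En n) where
  rIn := 1 / (2 * (k + 1))
  rOut := 1 / (k + 1)
  rIn_pos := by positivity
  rIn_lt_rOut := by
    apply one_div_lt_one_div_of_lt <;> nlinarith [(Nat.cast_nonneg k : (0 : ℝ) ≤ k)]

/-- The mollification of `g` by the `k`-th bump function. -/
def mollify {n : ℕ} (k : ℕ) (g : En n → ℝ) : En n → ℝ :=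
  (shrinkingBump n k).normed volume ⋆[ContinuousLinearMap.lsmul ℝ ℝ, volume] g

theorem mollify_apply {n : ℕ} (k : ℕ) (g : En n → ℝ) (x : En n) :
    mollify k g x = ∫ y, (shrinkingBump n k).normed volume (x - y) * g y := by
  rw [mollify, convolution_eq_swap]
  simp

theorem ae_tendsto_mollify {n : ℕ} {g : En n → ℝ} (hg : LocallyIntegrable g volume) :
    ∀ᵐ x, Tendsto (fun k => mollify k g x) atTop (𝓝 (g x)) := by
  apply ContDiffBump.ae_convolution_tendsto_right_of_locallyIntegrable (K := 2) _ _ hg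
  · exact tendsto_one_div_add_atTop_nhds_zero_nat
  · refine Eventually.of_forall fun k => ?_
    simp only [shrinkingBump]
    apply le_of_eq
    field_simp

theorem integrable_mollify {n : ℕ} (k : ℕ) {g : En n → ℝ} (hg : Integrable g) :
    Integrable (mollify k g) :=
  (ContDiffBump.integrable_normed _).integrable_convolution _ hg

theorem mollify_nonneg {n : ℕ} (k : ℕ) {g : En n → ℝ} (hg : ∀ x, 0 ≤ g x) (x : En n) :
    0 ≤ mollify k g x := by
  rw [mollify_apply]
  exact integral_nonneg fun y => mul_nonneg (ContDiffBump.nonneg_normed _ _) (hg y)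

theorem contDiff_mollify {n : ℕ} (k : ℕ) {g : En n → ℝ} (hg : LocallyIntegrable g volume) :
    ContDiff ℝ 1 (mollify k g) :=
  HasCompactSupport.contDiff_convolution_left (n := 1) _ (ContDiffBump.hasCompactSupport_normed _)
    (ContDiffBump.contDiff_normed _) hg

theorem tendsto_integral_abs_mollify_sub_of_nonneg {n : ℕ} {g : En n → ℝ} (hg : Integrable g)
    (h0 : ∀ x, 0 ≤ g x) : Tendsto (fun k => ∫ x, |mollify k g x - g x|) atTop (𝓝 0) := by
  have hInt : ∀ k, ∫ x, mollify k g x = ∫ x, g x := fun k => by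
    rw [mollify, integral_convolution _ (ContDiffBump.integrable_normed _) hg,
      ContDiffBump.integral_normed]
    simp
  have heq : ∀ k, ∫ x, |mollify k g x - g x| = 2 * ∫ x, max (g x - mollify k g x) 0 := fun k => by
    have h1 : ∀ x, |mollify k g x - g x| =
        2 * max (g x - mollify k g x) 0 + (mollify k g x - g x) := fun x => by
      rcases le_total (g x - mollify k g x) 0 with h | h
      · rw [max_eq_right h, abs_of_nonneg (by linarith)]; ring
      · rw [max_eq_left h, abs_of_nonpos (by linarith)]; ring
    simp_rw [h1]
    have h2 : Integrable fun x => max (g x - mollify k g x) 0 :=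
      (hg.sub (integrable_mollify k hg)).pos_part
    have h3 : Integrable fun x => mollify k g x - g x := (integrable_mollify k hg).sub hg
    rw [integral_add (h2.const_mul 2) h3,
      integral_sub (integrable_mollify k hg) hg, hInt, integral_const_mul]
    ring
  simp_rw [heq]
  suffices Tendsto (fun k => ∫ x, max (g x - mollify k g x) 0) atTop (𝓝 (∫ _ : En n, (0 : ℝ))) by
    simpa using this.const_mul 2
  apply tendsto_integral_of_dominated_convergence g
  · exact fun k => (hg.sub (integrable_mollify k hg)).pos_part.aestronglyMeasurable
  · exact hg
  · refine fun k => Eventually.of_forall fun x => ?_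
    rw [Real.norm_of_nonneg (le_max_right _ _)]
    exact max_le (by linarith [mollify_nonneg k h0 x]) (h0 x)
  · filter_upwards [ae_tendsto_mollify hg.locallyIntegrable] with x hx
    have := (tendsto_const_nhds (x := g x)).sub hx
    rw [sub_self] at this
    simpa using this.max (tendsto_const_nhds (x := (0 : ℝ)))

theorem mollify_sub {n : ℕ} (k : ℕ) {f g : En n → ℝ} (hf : LocallyIntegrable f volume)
    (hg : LocallyIntegrable g volume) (x : En n) :
    mollify k (fun y => f y - g y) x = mollify k f x - mollify k g x := by
  have h : ∀ {f : En n → ℝ}, LocallyIntegrable f volume →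
      Integrable (fun y => (shrinkingBump n k).normed volume (x - y) * f y) := fun hf => by
    refine hf.integrable_smul_left_of_hasCompactSupport
      (g := fun y => (shrinkingBump n k).normed volume (x - y))
      ((ContDiffBump.continuous_normed _).comp (by fun_prop)) ?_
    exact (ContDiffBump.hasCompactSupport_normed _).comp_homeomorph (Homeomorph.subLeft x)
  simp_rw [mollify_apply, mul_sub]
  exact integral_sub (h hf) (h hg)

theorem tendsto_integral_abs_mollify_sub {n : ℕ} {g : En n → ℝ} (hg : Integrable g) :
    Tendsto (fun k => ∫ x, |mollify k g x - g x|) atTop (𝓝 0) := by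
  have hp := hg.pos_part
  have hn := hg.neg_part
  have := (tendsto_integral_abs_mollify_sub_of_nonneg hp (fun x => le_max_right _ _)).add
    (tendsto_integral_abs_mollify_sub_of_nonneg hn (fun x => le_max_right _ _))
  rw [add_zero] at this
  refine squeeze_zero (fun k => integral_nonneg fun x => abs_nonneg _) (fun k => ?_) this
  have i1 : Integrable fun x => |mollify k (fun a => max (g a) 0) x - max (g x) 0| :=
    ((integrable_mollify k hp).sub hp).abs
  have i2 : Integrable fun x => |mollify k (fun a => max (-g a) 0) x - max (-g x) 0| :=
    ((integrable_mollify k hn).sub hn).abs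
  rw [← integral_add i1 i2]
  refine integral_mono ((integrable_mollify k hg).sub hg).abs (i1.add i2) fun x => ?_
  have e : ∀ y, g y = max (g y) 0 - max (-g y) 0 := fun y => by
    rcases le_total (g y) 0 with h | h
    · rw [max_eq_right h, max_eq_left (by linarith)]; ring
    · rw [max_eq_left h, max_eq_right (by linarith)]; ring
  have e2 : mollify k g x = mollify k (fun y => max (g y) 0) x -
      mollify k (fun y => max (-g y) 0) x := by
    rw [← mollify_sub k hp.locallyIntegrable hn.locallyIntegrable]
    simp_rw [← e]
  simp only [e2]
  calc _ = |(mollify k (fun y => max (g y) 0) x - max (g x) 0) -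
          (mollify k (fun y => max (-g y) 0) x - max (-g x) 0)| := by
        congr 1; linarith [e x]
    _ ≤ _ := abs_sub _ _

theorem tendsto_setIntegral_abs_mollify_sub {n : ℕ} {g : En n → ℝ}
    (hg : LocallyIntegrable g volume) {K : Set (En n)} (hK : IsCompact K) :
    Tendsto (fun k => ∫ x in K, |mollify k g x - g x|) atTop (𝓝 0) := by
  set B := Metric.cthickening 1 K with hB
  have hBm : MeasurableSet B := Metric.isClosed_cthickening.measurableSet
  have hgB : Integrable (B.indicator g) :=
    (hg.integrableOn_isCompact hK.cthickening).integrable_indicator hBm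
  refine squeeze_zero (fun k => integral_nonneg fun x => abs_nonneg _) (fun k => ?_)
    (tendsto_integral_abs_mollify_sub hgB)
  have hi := ((integrable_mollify k hgB).sub hgB).abs
  refine le_trans (le_of_eq ?_) (setIntegral_le_integral (s := K) hi
    (Eventually.of_forall fun x => abs_nonneg _))
  refine setIntegral_congr_fun hK.measurableSet fun x hx => ?_
  have hxB : x ∈ B := Metric.self_subset_cthickening K hx
  have : mollify k (B.indicator g) x = mollify k g x := by
    rw [mollify_apply, mollify_apply]
    congr 1; ext y
    by_cases hy : y ∈ B
    · rw [indicator_of_mem hy]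
    · rw [indicator_of_notMem hy, mul_zero]
      symm
      apply mul_eq_zero_of_left
      by_contra hne
      have : x - y ∈ Function.support ((shrinkingBump n k).normed volume) := hne
      rw [ContDiffBump.support_normed_eq, mem_ball_zero_iff] at this
      apply hy
      refine Metric.mem_cthickening_of_dist_le y x 1 K hx ?_
      rw [dist_comm, dist_eq_norm]
      refine this.le.trans ?_
      simp only [shrinkingBump]
      rw [div_le_one (by positivity)]
      linarith [(Nat.cast_nonneg k : (0 : ℝ) ≤ k)]
  simp only [this, indicator_of_mem hxB]

theorem HasWeakGradient.fderiv_mollify {n : ℕ} {u : En n → ℝ} {Du : En n → En n}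
    (h : HasWeakGradient u Du) (k : ℕ) (i : Fin n) (x : En n) :
    fderiv ℝ (mollify k u) x (EuclideanSpace.single i 1) = mollify k (fun y => Du y i) x := by
  have hs : HasCompactSupport ((shrinkingBump n k).normed volume) :=
    ContDiffBump.hasCompactSupport_normed _
  have hc : ContDiff ℝ (⊤ : ℕ∞) ((shrinkingBump n k).normed volume) :=
    ContDiffBump.contDiff_normed _
  have hd := HasCompactSupport.hasFDerivAt_convolution_left (ContinuousLinearMap.lsmul ℝ ℝ)
    hs (hc.of_le (by simp)) h.1 x
  have hfc : Continuous (fderiv ℝ ((shrinkingBump n k).normed volume)) :=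
    hc.continuous_fderiv (by simp)
  have hInt := (HasCompactSupport.convolutionExists_left
    (ContinuousLinearMap.precompL (En n) (ContinuousLinearMap.lsmul ℝ ℝ : ℝ →L[ℝ] ℝ →L[ℝ] ℝ))
    (hs.fderiv ℝ) hfc h.1 x).integrable_swap
  rw [mollify, hd.fderiv, convolution_eq_swap, ContinuousLinearMap.integral_apply hInt,
    mollify_apply]
  have key := h.2.2 (fun y => (shrinkingBump n k).normed volume (x - y))
    (hc.comp (by fun_prop)) (hs.comp_homeomorph (Homeomorph.subLeft x)) i
  have hfd : ∀ y, fderiv ℝ (fun y => (shrinkingBump n k).normed volume (x - y)) y =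
      - fderiv ℝ ((shrinkingBump n k).normed volume) (x - y) := fun y => by
    have := ((hc.differentiable (by simp)) (x - y)).hasFDerivAt.comp y
      ((hasFDerivAt_id y).const_sub x)
    refine (HasFDerivAt.fderiv this).trans ?_
    ext v
    simp
  simp_rw [hfd] at key
  simp only [neg_apply, mul_neg, integral_neg, neg_inj] at key
  simp_rw [mul_comm _ (Du _ i)]
  rw [← key]
  congr 1; ext y
  simp [mul_comm]

theorem MeasureTheory.LocallyIntegrable.euclidean_apply {n : ℕ} {G : En n → En n}
    (h : LocallyIntegrable G volume) (i : Fin n) : LocallyIntegrable (fun x => G x i) volume :=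
  h.mono ((EuclideanSpace.proj (𝕜 := ℝ) i).continuous.comp_aestronglyMeasurable
    h.aestronglyMeasurable) (Eventually.of_forall fun x => PiLp.norm_apply_le (G x) i)

theorem MeasureTheory.LocallyIntegrable.norm' {n : ℕ} {E : Type*} [NormedAddCommGroup E]
    {G : En n → E} (h : LocallyIntegrable G volume) :
    LocallyIntegrable (fun x => ‖G x‖) volume :=
  h.mono h.aestronglyMeasurable.norm (Eventually.of_forall fun x => (norm_norm (G x)).le)

/-- Convergence in `L¹` on the support of a test function gives convergence of the pairing. -/
theorem tendsto_integral_mul_of_tendsto_setIntegral_abs_sub {n : ℕ} {f : ℕ → En n → ℝ}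
    {g η : En n → ℝ} (hf : ∀ k, LocallyIntegrable (f k) volume) (hg : LocallyIntegrable g volume)
    (hη : Continuous η) (hs : HasCompactSupport η) {K : Set (En n)} (hK : IsCompact K)
    (hηK : ∀ x ∉ K, η x = 0)
    (h : Tendsto (fun k => ∫ x in K, |f k x - g x|) atTop (𝓝 0)) :
    Tendsto (fun k => ∫ x, f k x * η x) atTop (𝓝 (∫ x, g x * η x)) := by
  obtain ⟨S, hS⟩ := hs.exists_bound_of_continuous hη
  rw [tendsto_iff_norm_sub_tendsto_zero]
  refine squeeze_zero (fun _ => norm_nonneg _) (fun k => ?_) (by simpa using h.const_mul S)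
  have i1 : Integrable fun x => f k x * η x :=
    (hf k).integrable_smul_right_of_hasCompactSupport hη hs
  have i2 : Integrable fun x => g x * η x := hg.integrable_smul_right_of_hasCompactSupport hη hs
  have hz : ∀ x, x ∉ K → f k x * η x - g x * η x = 0 := fun x hx => by simp [hηK x hx]
  rw [← integral_sub i1 i2, ← setIntegral_eq_integral_of_forall_compl_eq_zero hz,
    ← integral_const_mul]
  refine norm_integral_le_of_norm_le
    ((((hf k).sub hg).integrableOn_isCompact hK).abs.const_mul S) (Eventually.of_forall fun x => ?_)
  rw [← sub_mul, norm_mul, mul_comm]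
  exact mul_le_mul_of_nonneg_right (hS x) (norm_nonneg _)

theorem continuous_fderiv_apply_of_contDiff {n : ℕ} {φ : En n → ℝ} (h : ContDiff ℝ (⊤ : ℕ∞) φ)
    (v : En n) : Continuous fun x => fderiv ℝ φ x v :=
  (h.continuous_fderiv (by simp)).clm_apply continuous_const

theorem hasCompactSupport_fderiv_apply {n : ℕ} {φ : En n → ℝ} (h : HasCompactSupport φ)
    (v : En n) : HasCompactSupport fun x => fderiv ℝ φ x v :=
  h.fderiv_apply ℝ v

theorem fderiv_apply_eq_zero_of_notMem_tsupport {n : ℕ} {φ : En n → ℝ} (v : En n) {x : En n}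
    (hx : x ∉ tsupport φ) : fderiv ℝ φ x v = 0 := by
  have : fderiv ℝ φ x = 0 := by
    by_contra h
    exact hx (support_fderiv_subset ℝ h)
  rw [this]; rfl

theorem abs_sub_le_of_abs_deriv_le {F : ℝ → ℝ} (hF : ContDiff ℝ 1 F) {M : ℝ}
    (hM : ∀ t, |deriv F t| ≤ M) (s t : ℝ) : |F s - F t| ≤ M * |s - t| := by
  have := Convex.norm_image_sub_le_of_norm_deriv_le (f := F) (s := univ) (C := M)
    (fun x _ => (hF.differentiable (by simp)) x) (fun x _ => hM x) convex_univ (mem_univ t)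
    (mem_univ s)
  simpa using this

theorem locallyIntegrable_of_abs_le {n : ℕ} {u w : En n → ℝ} (h : LocallyIntegrable u volume)
    (hw : AEStronglyMeasurable w) (a b : ℝ) (hb : ∀ x, |w x| ≤ a + b * |u x|) :
    LocallyIntegrable w volume := by
  have : LocallyIntegrable (fun x => a + b * |u x|) volume :=
    (locallyIntegrable_const a).add (h.norm'.smul b)
  refine this.mono hw (Eventually.of_forall fun x => ?_)
  exact (hb x).trans (le_abs_self _)

theorem locallyIntegrable_mul_smul {n : ℕ} {u : En n → ℝ} {G : En n → En n}
    (h : LocallyIntegrable G volume) (hu : AEStronglyMeasurable u) {χ : ℝ → ℝ}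
    (hχ : Measurable χ) {M : ℝ} (hM : ∀ t, |χ t| ≤ M) :
    LocallyIntegrable (fun x => χ (u x) • G x) volume := by
  refine (h.norm'.smul M).mono ((hχ.comp_aemeasurable hu.aemeasurable).aestronglyMeasurable.smul
    h.aestronglyMeasurable) (Eventually.of_forall fun x => ?_)
  simp only [norm_smul, Pi.smul_apply, norm_norm]
  exact mul_le_mul_of_nonneg_right ((hM _).trans (le_abs_self _)) (norm_nonneg _)

theorem HasWeakGradient.comp_contDiff {n : ℕ} {u : En n → ℝ} {Du : En n → En n}
    (h : HasWeakGradient u Du) {F : ℝ → ℝ} (hF : ContDiff ℝ 1 F) {M : ℝ}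
    (hM : ∀ t, |deriv F t| ≤ M) :
    HasWeakGradient (fun x => F (u x)) (fun x => deriv F (u x) • Du x) := by
  have hlip := abs_sub_le_of_abs_deriv_le hF hM
  have hdc : Continuous (deriv F) := hF.continuous_deriv (by simp)
  have hum := h.1.aestronglyMeasurable
  have hFu : LocallyIntegrable (fun x => F (u x)) volume := by
    refine locallyIntegrable_of_abs_le h.1 (hF.continuous.comp_aestronglyMeasurable hum)
      |F 0| M fun x => ?_
    have := hlip (u x) 0
    rw [sub_zero] at this
    have h2 := abs_add_le (F 0) (F (u x) - F 0)
    rw [add_sub_cancel] at h2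
    linarith
  have hFD := locallyIntegrable_mul_smul h.2.1 hum hdc.measurable hM
  refine ⟨hFu, hFD, fun φ hφ hs i => ?_⟩
  have hD := h.2.1.euclidean_apply i
  have hK : IsCompact (tsupport φ) := hs
  have hw : ∀ k, ContDiff ℝ 1 (mollify k u) := fun k => contDiff_mollify k h.1
  have hdk : ∀ k, Continuous (mollify k fun y => Du y i) := fun k =>
    (contDiff_mollify k hD).continuous
  have hφc : Continuous φ := hφ.continuous
  have hpart : ∀ k, ∫ x, F (mollify k u x) * fderiv ℝ φ x (EuclideanSpace.single i 1) =
      - ∫ x, deriv F (mollify k u x) * mollify k (fun y => Du y i) x * φ x := fun k => by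
    have hfd : ∀ x, fderiv ℝ (fun x => F (mollify k u x)) x (EuclideanSpace.single i 1) =
        deriv F (mollify k u x) * mollify k (fun y => Du y i) x := fun x => by
      have h1 := ((hF.differentiable (by simp)) (mollify k u x)).hasDerivAt.comp_hasFDerivAt x
        (((hw k).differentiable (by simp)) x).hasFDerivAt
      have h2 : fderiv ℝ (fun x => F (mollify k u x)) x = _ := HasFDerivAt.fderiv h1
      rw [h2, ← h.fderiv_mollify k i x]
      simp
    simp_rw [← hfd]
    apply integral_mul_fderiv_eq_neg_fderiv_mul_of_integrable
    · simp_rw [hfd]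
      exact (((hdc.comp (hw k).continuous).mul (hdk k)).mul hφc).integrable_of_hasCompactSupport
        hs.mul_left
    · exact ((hF.continuous.comp (hw k).continuous).mul
        (continuous_fderiv_apply_of_contDiff hφ _)).integrable_of_hasCompactSupport
        (hasCompactSupport_fderiv_apply hs _).mul_left
    · exact ((hF.continuous.comp (hw k).continuous).mul hφc).integrable_of_hasCompactSupport
        hs.mul_left
    · exact fun x _ => ((hF.comp (hw k)).differentiable (by simp)) x
    · exact fun x _ => (hφ.differentiable (by simp)) x
  have hwl : ∀ k, LocallyIntegrable (mollify k u) volume := fun k =>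
    (hw k).continuous.locallyIntegrable
  have hdl : ∀ k, LocallyIntegrable (mollify k fun y => Du y i) volume := fun k =>
    (hdk k).locallyIntegrable
  have hgl : ∀ k, LocallyIntegrable
      (fun x => deriv F (mollify k u x) * mollify k (fun y => Du y i) x) volume := fun k =>
    ((hdc.comp (hw k).continuous).mul (hdk k)).locallyIntegrable
  have hFDi : LocallyIntegrable (fun x => deriv F (u x) * Du x i) volume := hFD.euclidean_apply i
  have l1 := tendsto_integral_mul_of_tendsto_setIntegral_abs_sub
    (fun k => (hF.continuous.comp (hw k).continuous).locallyIntegrable) hFu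
    (continuous_fderiv_apply_of_contDiff hφ (EuclideanSpace.single i 1))
    (hasCompactSupport_fderiv_apply hs _) hK
    (fun x hx => fderiv_apply_eq_zero_of_notMem_tsupport _ hx) (by
      refine squeeze_zero (fun k => integral_nonneg fun x => abs_nonneg _) (fun k => ?_)
        (by simpa using (tendsto_setIntegral_abs_mollify_sub h.1 hK).const_mul M)
      rw [← integral_const_mul]
      refine integral_mono ?_ ?_ fun x => hlip _ _
      · exact (((hF.continuous.comp (hw k).continuous).locallyIntegrable.sub
          hFu).integrableOn_isCompact hK).abs
      · exact ((((hwl k).sub h.1).integrableOn_isCompact hK).abs.const_mul M))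
  have hdom : Tendsto (fun k => ∫ x in tsupport φ,
      |deriv F (mollify k u x) - deriv F (u x)| * |Du x i|) atTop (𝓝 0) := by
    rw [show (0 : ℝ) = ∫ x in tsupport φ, (0 : ℝ) by simp]
    apply tendsto_integral_of_dominated_convergence (fun x => 2 * M * |Du x i|)
    · intro k
      have h1 : AEStronglyMeasurable (fun x => deriv F (mollify k u x) - deriv F (u x)) volume :=
        (hdc.comp (hw k).continuous).aestronglyMeasurable.sub
          (hdc.comp_aestronglyMeasurable hum)
      exact (h1.norm.mul hD.aestronglyMeasurable.norm).restrict
    · exact ((hD.integrableOn_isCompact hK).abs.const_mul _)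
    · refine fun k => Eventually.of_forall fun x => ?_
      rw [Real.norm_of_nonneg (by positivity)]
      refine mul_le_mul_of_nonneg_right ?_ (abs_nonneg _)
      refine (abs_sub _ _).trans ?_
      linarith [hM (mollify k u x), hM (u x)]
    · refine ae_restrict_of_ae ?_
      filter_upwards [ae_tendsto_mollify h.1] with x hx
      have := ((hdc.tendsto (u x)).comp hx).sub_const (deriv F (u x))
      rw [sub_self] at this
      simpa using this.abs.mul_const |Du x i|
  have l2 := tendsto_integral_mul_of_tendsto_setIntegral_abs_sub hgl hFDi hφc hs hK
    (fun x hx => image_eq_zero_of_notMem_tsupport hx) (by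
      refine squeeze_zero (fun k => integral_nonneg fun x => abs_nonneg _) (fun k => ?_)
        (by simpa using ((tendsto_setIntegral_abs_mollify_sub hD hK).const_mul M).add hdom)
      have j1 : IntegrableOn (fun x => M * |mollify k (fun y => Du y i) x - Du x i|)
          (tsupport φ) := ((((hdl k).sub hD).integrableOn_isCompact hK).abs.const_mul M)
      have j2 : IntegrableOn (fun x => |deriv F (mollify k u x) - deriv F (u x)| * |Du x i|)
          (tsupport φ) := by
        refine ((hD.integrableOn_isCompact hK).abs.const_mul (2 * M)).mono' ?_
          (Eventually.of_forall fun x => ?_)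
        · have h1 : AEStronglyMeasurable (fun x => deriv F (mollify k u x) - deriv F (u x))
              volume := (hdc.comp (hw k).continuous).aestronglyMeasurable.sub
            (hdc.comp_aestronglyMeasurable hum)
          exact (h1.norm.mul hD.aestronglyMeasurable.norm).restrict
        · rw [Real.norm_of_nonneg (by positivity)]
          refine mul_le_mul_of_nonneg_right ?_ (abs_nonneg _)
          refine (abs_sub _ _).trans ?_
          linarith [hM (mollify k u x), hM (u x)]
      rw [← integral_const_mul, ← integral_add j1 j2]
      refine integral_mono (((hgl k).sub hFDi).integrableOn_isCompact hK).abs (j1.add j2)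
        fun x => ?_
      calc |deriv F (mollify k u x) * mollify k (fun y => Du y i) x - deriv F (u x) * Du x i|
          = |deriv F (mollify k u x) * (mollify k (fun y => Du y i) x - Du x i) +
            (deriv F (mollify k u x) - deriv F (u x)) * Du x i| := by congr 1; ring
        _ ≤ _ := (abs_add_le _ _).trans (by
          rw [abs_mul, abs_mul]
          exact add_le_add_left (mul_le_mul_of_nonneg_right (hM _) (abs_nonneg _)) _))
  have := tendsto_nhds_unique (l1.congr hpart) l2.neg
  simpa using this

theorem HasWeakGradient.congr_ae {n : ℕ} {u : En n → ℝ} {Du G : En n → En n}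
    (h : HasWeakGradient u Du) (hG : Du =ᵐ[volume] G) : HasWeakGradient u G := by
  refine ⟨h.1, h.2.1.mono (h.2.1.aestronglyMeasurable.congr hG)
    (hG.mono fun x hx => by rw [hx]), fun φ hφ hs i => ?_⟩
  rw [h.2.2 φ hφ hs i]
  congr 1
  exact integral_congr_ae (hG.mono fun x hx => by simp only [hx])

theorem HasWeakGradient.ae_eq {n : ℕ} {u : En n → ℝ} {G H : En n → En n}
    (hG : HasWeakGradient u G) (hH : HasWeakGradient u H) : G =ᵐ[volume] H := by
  have : ∀ i, ∀ᵐ x, G x i = H x i := fun i => by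
    refine ae_eq_of_integral_contDiff_smul_eq (hG.2.1.euclidean_apply i)
      (hH.2.1.euclidean_apply i) fun φ hφ hs => ?_
    have := (hG.2.2 φ hφ hs i).symm.trans (hH.2.2 φ hφ hs i)
    simpa [mul_comm] using this
  filter_upwards [ae_all_iff.2 this] with x hx
  ext i
  exact hx i

theorem HasWeakGradient.add {n : ℕ} {u v : En n → ℝ} {G H : En n → En n}
    (hG : HasWeakGradient u G) (hH : HasWeakGradient v H) :
    HasWeakGradient (fun x => u x + v x) (fun x => G x + H x) := by
  refine ⟨hG.1.add hH.1, hG.2.1.add hH.2.1, fun φ hφ hs i => ?_⟩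
  have hd := continuous_fderiv_apply_of_contDiff hφ (EuclideanSpace.single i 1)
  have hds := hasCompactSupport_fderiv_apply hs (EuclideanSpace.single i 1)
  simp only [PiLp.add_apply, add_mul]
  have i1 : Integrable fun x => u x * fderiv ℝ φ x (EuclideanSpace.single i 1) :=
    hG.1.integrable_smul_right_of_hasCompactSupport hd hds
  have i2 : Integrable fun x => v x * fderiv ℝ φ x (EuclideanSpace.single i 1) :=
    hH.1.integrable_smul_right_of_hasCompactSupport hd hds
  have i3 : Integrable fun x => G x i * φ x :=
    (hG.2.1.euclidean_apply i).integrable_smul_right_of_hasCompactSupport hφ.continuous hs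
  have i4 : Integrable fun x => H x i * φ x :=
    (hH.2.1.euclidean_apply i).integrable_smul_right_of_hasCompactSupport hφ.continuous hs
  rw [integral_add i1 i2, integral_add i3 i4, hG.2.2 φ hφ hs i, hH.2.2 φ hφ hs i]
  ring

theorem HasWeakGradient.const_mul {n : ℕ} {u : En n → ℝ} {G : En n → En n}
    (hG : HasWeakGradient u G) (c : ℝ) :
    HasWeakGradient (fun x => c * u x) (fun x => c • G x) := by
  refine ⟨hG.1.smul c, hG.2.1.smul c, fun φ hφ hs i => ?_⟩
  simp only [PiLp.smul_apply, smul_eq_mul, mul_assoc]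
  rw [integral_const_mul, integral_const_mul, hG.2.2 φ hφ hs i]
  ring

theorem HasWeakGradient.sub {n : ℕ} {u v : En n → ℝ} {G H : En n → En n}
    (hG : HasWeakGradient u G) (hH : HasWeakGradient v H) :
    HasWeakGradient (fun x => u x - v x) (fun x => G x - H x) := by
  simpa [sub_eq_add_neg] using hG.add (hH.const_mul (-1))

theorem HasWeakGradient.sub_const {n : ℕ} {u : En n → ℝ} {G : En n → En n}
    (hG : HasWeakGradient u G) (c : ℝ) : HasWeakGradient (fun x => u x - c) G := by
  have hd : ∀ t : ℝ, deriv (fun t : ℝ => t - c) t = 1 := fun t => by simp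
  have := hG.comp_contDiff (F := fun t => t - c) (M := 1) (by fun_prop) (fun t => by simp)
  simpa [hd] using this

theorem hasWeakGradient_zero {n : ℕ} :
    HasWeakGradient (fun _ : En n => (0 : ℝ)) (fun _ => 0) :=
  ⟨locallyIntegrable_const 0, locallyIntegrable_const 0, fun φ _ _ i => by simp⟩

/-- The chain rule passes to pointwise limits of uniformly Lipschitz nonlinearities. -/
theorem HasWeakGradient.comp_of_tendsto {n : ℕ} {u : En n → ℝ} {Du : En n → En n}
    (h : HasWeakGradient u Du) {F : ℕ → ℝ → ℝ} {f χ : ℝ → ℝ} (hF : ∀ k, ContDiff ℝ 1 (F k))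
    (hM : ∀ k t, |deriv (F k) t| ≤ 1) {a : ℝ} (h0 : ∀ k, |F k 0| ≤ a)
    (hf : ∀ t, Tendsto (fun k => F k t) atTop (𝓝 (f t)))
    (hχ : ∀ t, Tendsto (fun k => deriv (F k) t) atTop (𝓝 (χ t))) :
    HasWeakGradient (fun x => f (u x)) (fun x => χ (u x) • Du x) := by
  have hum := h.1.aestronglyMeasurable
  have hb : ∀ k t, |F k t| ≤ a + 1 * |t| := fun k t => by
    have h1 := abs_sub_le_of_abs_deriv_le (hF k) (hM k) t 0
    rw [sub_zero] at h1
    have h2 := abs_add_le (F k 0) (F k t - F k 0)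
    rw [add_sub_cancel] at h2
    linarith [h0 k]
  have hfb : ∀ t, |f t| ≤ a + 1 * |t| := fun t =>
    le_of_tendsto (hf t).abs (Eventually.of_forall fun k => hb k t)
  have hχb : ∀ t, |χ t| ≤ 1 := fun t =>
    le_of_tendsto (hχ t).abs (Eventually.of_forall fun k => hM k t)
  have hfm : Measurable f :=
    measurable_of_tendsto_metrizable (fun k => (hF k).continuous.measurable)
      (tendsto_pi_nhds.2 hf)
  have hχm : Measurable χ :=
    measurable_of_tendsto_metrizable
      (fun k => ((hF k).continuous_deriv (by simp)).measurable) (tendsto_pi_nhds.2 hχ)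
  have hk := fun k => h.comp_contDiff (hF k) (hM k)
  have hfu : LocallyIntegrable (fun x => f (u x)) volume :=
    locallyIntegrable_of_abs_le h.1
      (hfm.comp_aemeasurable hum.aemeasurable).aestronglyMeasurable a 1 fun x => hfb (u x)
  refine ⟨hfu, locallyIntegrable_mul_smul h.2.1 hum hχm hχb, fun φ hφ hs i => ?_⟩
  have hD := h.2.1.euclidean_apply i
  have hd := continuous_fderiv_apply_of_contDiff hφ (EuclideanSpace.single i 1)
  have hds := hasCompactSupport_fderiv_apply hs (EuclideanSpace.single i 1)
  have l1 : Tendsto (fun k => ∫ x, F k (u x) * fderiv ℝ φ x (EuclideanSpace.single i 1)) atTop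
      (𝓝 (∫ x, f (u x) * fderiv ℝ φ x (EuclideanSpace.single i 1))) := by
    apply tendsto_integral_of_dominated_convergence
      (fun x => (a + 1 * |u x|) * |fderiv ℝ φ x (EuclideanSpace.single i 1)|)
    · exact fun k => ((hF k).continuous.comp_aestronglyMeasurable hum).mul
        hd.aestronglyMeasurable
    · exact ((locallyIntegrable_const a).add
        (h.1.norm'.smul (1 : ℝ))).integrable_smul_right_of_hasCompactSupport hd.abs hds.abs
    · refine fun k => Eventually.of_forall fun x => ?_
      rw [norm_mul]
      exact mul_le_mul_of_nonneg_right (hb k _) (abs_nonneg _)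
    · exact Eventually.of_forall fun x => (hf (u x)).mul_const _
  have l2 : Tendsto (fun k => ∫ x, (deriv (F k) (u x) • Du x) i * φ x) atTop
      (𝓝 (∫ x, (χ (u x) • Du x) i * φ x)) := by
    apply tendsto_integral_of_dominated_convergence (fun x => |Du x i| * |φ x|)
    · exact fun k => ((hk k).2.1.euclidean_apply i).aestronglyMeasurable.mul
        hφ.continuous.aestronglyMeasurable
    · exact hD.norm'.integrable_smul_right_of_hasCompactSupport hφ.continuous.abs hs.abs
    · refine fun k => Eventually.of_forall fun x => ?_
      simp only [PiLp.smul_apply, smul_eq_mul, norm_mul, Real.norm_eq_abs]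
      refine mul_le_mul_of_nonneg_right ?_ (abs_nonneg _)
      exact mul_le_of_le_one_left (abs_nonneg _) (hM k _)
    · refine Eventually.of_forall fun x => ?_
      simp only [PiLp.smul_apply, smul_eq_mul]
      exact ((hχ (u x)).mul_const _).mul_const _
  exact tendsto_nhds_unique (l1.congr fun k => (hk k).2.2 φ hφ hs i) l2.neg

/-- The weak gradient vanishes almost everywhere on level sets. -/
theorem HasWeakGradient.ae_eq_zero_of_eq {n : ℕ} {u : En n → ℝ} {Du : En n → En n}
    (h : HasWeakGradient u Du) (c : ℝ) : ∀ᵐ x, u x = c → Du x = 0 := by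
  have hder : ∀ (k : ℕ) (t : ℝ), HasDerivAt (fun t : ℝ => Real.arctan ((k + 1) * t) / (k + 1))
      (1 / (1 + ((k + 1) * t) ^ 2)) t := fun k t => by
    have h1 : HasDerivAt (fun t : ℝ => ((k : ℝ) + 1) * t) ((k : ℝ) + 1) t := by
      simpa using (hasDerivAt_id t).const_mul ((k : ℝ) + 1)
    refine (h1.arctan.div_const ((k : ℝ) + 1)).congr_deriv ?_
    field_simp
  have hlin : Tendsto (fun k : ℕ => (k : ℝ) + 1) atTop atTop :=
    tendsto_atTop_add_const_right _ _ tendsto_natCast_atTop_atTop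
  have key := (h.sub_const c).comp_of_tendsto
    (F := fun (k : ℕ) t => Real.arctan ((k + 1) * t) / (k + 1))
    (f := fun _ => 0) (χ := fun t => if t = 0 then 1 else 0) (a := 0)
    (fun k => (Real.contDiff_arctan.comp (by fun_prop)).div_const _)
    (fun k t => by
      rw [(hder k t).deriv, abs_of_nonneg (by positivity)]
      exact div_le_one_of_le₀ (by nlinarith [sq_nonneg (((k : ℝ) + 1) * t)]) (by positivity))
    (fun k => by simp)
    (fun t => by
      refine squeeze_zero_norm (a := fun k : ℕ => (Real.pi / 2) / ((k : ℝ) + 1)) (fun k => ?_)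
        (hlin.const_div_atTop _)
      rw [norm_div, Real.norm_of_nonneg (by positivity : (0 : ℝ) ≤ (k : ℝ) + 1)]
      refine div_le_div_of_nonneg_right ?_ (by positivity)
      exact abs_le.2 ⟨(Real.neg_pi_div_two_lt_arctan _).le, (Real.arctan_lt_pi_div_two _).le⟩)
    (fun t => by
      simp_rw [(hder _ t).deriv]
      split_ifs with ht
      · simp [ht]
      · refine Tendsto.const_div_atTop ?_ _
        refine tendsto_atTop_add_const_left _ _ ?_
        simp_rw [mul_pow]
        exact Tendsto.atTop_mul_const (by positivity)
          ((tendsto_pow_atTop (by norm_num)).comp hlin))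
  filter_upwards [key.ae_eq hasWeakGradient_zero] with x hx hc
  simpa [hc] using hx

theorem HasWeakGradient.posPart {n : ℕ} {u : En n → ℝ} {Du : En n → En n}
    (h : HasWeakGradient u Du) :
    HasWeakGradient (fun x => max (u x) 0) ({x | 0 < u x}.indicator Du) := by
  have hpos : ∀ (k : ℕ) (t : ℝ), 0 < t ^ 2 + (1 / ((k : ℝ) + 1)) ^ 2 := fun k t => by positivity
  have hle : ∀ (k : ℕ) (t : ℝ), |t| ≤ √(t ^ 2 + (1 / ((k : ℝ) + 1)) ^ 2) := fun k t =>
    Real.abs_le_sqrt (by nlinarith [sq_nonneg (1 / ((k : ℝ) + 1))])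
  have hder : ∀ (k : ℕ) (t : ℝ), HasDerivAt
      (fun t : ℝ => (√(t ^ 2 + (1 / ((k : ℝ) + 1)) ^ 2) + t) / 2)
      ((t / √(t ^ 2 + (1 / ((k : ℝ) + 1)) ^ 2) + 1) / 2) t := fun k t => by
    have h1 : HasDerivAt (fun t : ℝ => t ^ 2 + (1 / ((k : ℝ) + 1)) ^ 2) (2 * t) t := by
      simpa using (hasDerivAt_pow 2 t).add_const ((1 / ((k : ℝ) + 1)) ^ 2)
    refine (((h1.sqrt (hpos k t).ne').add (hasDerivAt_id t)).div_const 2).congr_deriv ?_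
    rw [mul_div_mul_left _ _ (by norm_num)]
  have hsq : ∀ t : ℝ, Tendsto (fun k : ℕ => √(t ^ 2 + (1 / ((k : ℝ) + 1)) ^ 2)) atTop (𝓝 |t|) :=
    fun t => by
      have := ((tendsto_one_div_add_atTop_nhds_zero_nat (𝕜 := ℝ)).pow 2).const_add (t ^ 2)
      simpa [Real.sqrt_sq_eq_abs] using this.sqrt
  have key := h.comp_of_tendsto
    (F := fun (k : ℕ) t => (√(t ^ 2 + (1 / ((k : ℝ) + 1)) ^ 2) + t) / 2)
    (f := fun t => max t 0)
    (χ := fun t => if t = 0 then 1 / 2 else (t / |t| + 1) / 2) (a := 1)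
    (fun k => by
      refine ContDiff.div_const (ContDiff.add (ContDiff.sqrt (by fun_prop) fun t => ?_)
        contDiff_id) 2
      exact (hpos k t).ne')
    (fun k t => by
      rw [(hder k t).deriv]
      have h1 : |t / √(t ^ 2 + (1 / ((k : ℝ) + 1)) ^ 2)| ≤ 1 := by
        rw [abs_div, abs_of_nonneg (Real.sqrt_nonneg _)]
        exact div_le_one_of_le₀ (hle k t) (Real.sqrt_nonneg _)
      rw [abs_le] at h1 ⊢
      constructor <;> linarith)
    (fun k => by
      have h1 : 1 / ((k : ℝ) + 1) ≤ 1 :=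
        div_le_one_of_le₀ (by linarith [(Nat.cast_nonneg k : (0 : ℝ) ≤ k)]) (by positivity)
      have h2 : (0 : ℝ) ≤ 1 / ((k : ℝ) + 1) := by positivity
      rw [zero_pow (by norm_num), zero_add, Real.sqrt_sq h2, add_zero,
        abs_of_nonneg (by positivity)]
      linarith)
    (fun t => by
      have := ((hsq t).add_const t).div_const 2
      convert this using 2
      rcases le_total t 0 with ht | ht
      · rw [max_eq_right ht, abs_of_nonpos ht]; ring
      · rw [max_eq_left ht, abs_of_nonneg ht]; ring)
    (fun t => by
      simp_rw [(hder _ t).deriv]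
      split_ifs with ht
      · simp [ht]
      · exact ((tendsto_const_nhds.div (hsq t) (abs_ne_zero.2 ht)).add_const 1).div_const 2)
  refine key.congr_ae ?_
  filter_upwards [h.ae_eq_zero_of_eq 0] with x hx
  rcases lt_trichotomy (u x) 0 with h' | h' | h'
  · simp [h'.ne, h'.le, abs_of_neg h']
  · simp [h', hx h']
  · simp [h'.ne', h', abs_of_pos h']

/-- The portion of `t` between the levels `a` and `a + δ`. -/
def layer (a δ t : ℝ) : ℝ := max (t - a) 0 - max (t - a - δ) 0

theorem HasWeakGradient.layer {n : ℕ} {u : En n → ℝ} {Du : En n → En n}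
    (h : HasWeakGradient u Du) (a : ℝ) {δ : ℝ} (hδ : 0 ≤ δ) :
    HasWeakGradient (fun x => layer a δ (u x)) ({x | a < u x ∧ u x < a + δ}.indicator Du) := by
  have h1 := (h.sub_const a).posPart.sub ((h.sub_const a).sub_const δ).posPart
  refine h1.congr_ae ?_
  filter_upwards [h.ae_eq_zero_of_eq (a + δ)] with x hx
  by_cases ha : a < u x
  · rcases lt_trichotomy (u x) (a + δ) with h' | h' | h'
    · rw [indicator_of_mem (by simpa using ha), indicator_of_notMem (by simp; linarith),
        indicator_of_mem (show x ∈ {x | a < u x ∧ u x < a + δ} from ⟨ha, h'⟩), sub_zero]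
    · rw [indicator_of_mem (by simpa using ha), indicator_of_notMem (by simp; linarith),
        indicator_of_notMem (by simp [h']), sub_zero, hx h']
    · rw [indicator_of_mem (by simpa using ha), indicator_of_mem (by simp; linarith),
        indicator_of_notMem (by simp [h'.le]), sub_self]
  · rw [indicator_of_notMem (by simpa using ha), indicator_of_notMem (by simp; linarith),
        indicator_of_notMem (by simp [ha]), sub_self]

theorem trunc_eq_layer {n : ℕ} (u : En n → ℝ) {K : ℝ} (hK : 0 ≤ K) (x : En n) :
    trunc u K x = layer (-K) (2 * K) (u x) - K := by
  simp only [trunc, layer, max_def, min_def]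
  split_ifs <;> linarith

theorem HasWeakGradient.trunc {n : ℕ} {u : En n → ℝ} {Du : En n → En n}
    (h : HasWeakGradient u Du) {K : ℝ} (hK : 0 ≤ K) :
    HasWeakGradient (trunc u K) ({x | |u x| ≤ K}.indicator Du) := by
  have h1 := (h.layer (-K) (δ := 2 * K) (by linarith)).sub_const K
  simp_rw [← trunc_eq_layer u hK] at h1
  refine h1.congr_ae ?_
  filter_upwards [h.ae_eq_zero_of_eq K, h.ae_eq_zero_of_eq (-K)] with x hx hx'
  symm
  by_cases hm : |u x| ≤ K
  · rw [indicator_of_mem (by exact hm)]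
    rw [abs_le] at hm
    by_cases e1 : u x = K
    · rw [hx e1]; exact (indicator_apply_eq_zero.2 fun _ => hx e1).symm
    by_cases e2 : u x = -K
    · rw [hx' e2]; exact (indicator_apply_eq_zero.2 fun _ => hx' e2).symm
    refine (indicator_of_mem ?_ _).symm
    exact ⟨lt_of_le_of_ne hm.1 (Ne.symm e2), by linarith [lt_of_le_of_ne hm.2 e1]⟩
  · rw [indicator_of_notMem (by exact hm)]
    refine (indicator_of_notMem (fun hc => hm ?_) _).symm
    have h1 := hc.1
    have h2 := hc.2
    exact abs_le.2 ⟨h1.le, by linarith⟩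

/-- The strictly convex function `√(1 + ‖ξ‖²)`. -/
def japaneseBracket {E : Type*} [NormedAddCommGroup E] (ξ : E) : ℝ := √(1 + ‖ξ‖ ^ 2)

theorem japaneseBracket_sq {E : Type*} [NormedAddCommGroup E] (ξ : E) :
    japaneseBracket ξ ^ 2 = 1 + ‖ξ‖ ^ 2 := Real.sq_sqrt (by positivity)

theorem one_le_japaneseBracket {E : Type*} [NormedAddCommGroup E] (ξ : E) :
    1 ≤ japaneseBracket ξ := Real.one_le_sqrt.2 (by nlinarith [sq_nonneg ‖ξ‖])

theorem japaneseBracket_le {E : Type*} [NormedAddCommGroup E] (ξ : E) :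
    japaneseBracket ξ ≤ 1 + ‖ξ‖ :=
  Real.sqrt_le_iff.2 ⟨by positivity, by nlinarith [norm_nonneg ξ]⟩

theorem continuous_japaneseBracket {E : Type*} [NormedAddCommGroup E] :
    Continuous (japaneseBracket : E → ℝ) := by
  unfold japaneseBracket; fun_prop

/-- The defect of convexity of `√(1 + ‖ξ‖²)` at the midpoint. -/
def convexityGap {E : Type*} [NormedAddCommGroup E] [InnerProductSpace ℝ E] (a b : E) : ℝ :=
  (japaneseBracket a + japaneseBracket b) / 2 -
    japaneseBracket ((1 / 2 : ℝ) • a + (1 / 2 : ℝ) • b)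

section gap
variable {E : Type*} [NormedAddCommGroup E] [InnerProductSpace ℝ E]

theorem norm_midpoint_sq (a b : E) : ‖(1 / 2 : ℝ) • a + (1 / 2 : ℝ) • b‖ ^ 2 =
    (‖a‖ ^ 2 + ‖b‖ ^ 2 + 2 * inner ℝ a b) / 4 := by
  rw [← smul_add, norm_smul, mul_pow, norm_add_sq_real]
  norm_num
  ring

theorem one_add_inner_le (a b : E) :
    |1 + inner ℝ a b| ≤ japaneseBracket a * japaneseBracket b := by
  apply abs_le_of_sq_le_sq
  · rw [mul_pow, japaneseBracket_sq, japaneseBracket_sq]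
    have h1 := norm_sub_sq_real a b
    have h2 := abs_real_inner_le_norm a b
    have h3 := sq_le_sq' (by linarith [neg_abs_le (inner ℝ a b)]) ((le_abs_self _).trans h2)
    nlinarith [sq_nonneg ‖a - b‖]
  · exact mul_nonneg (by linarith [one_le_japaneseBracket a]) (by linarith [one_le_japaneseBracket b])

theorem convexityGap_nonneg (a b : E) : 0 ≤ convexityGap a b := by
  have ha := one_le_japaneseBracket a
  have hb := one_le_japaneseBracket b
  have h := (le_abs_self _).trans (one_add_inner_le a b)
  rw [convexityGap, sub_nonneg]
  apply le_of_sq_le_sq _ (by linarith)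
  rw [japaneseBracket_sq, norm_midpoint_sq]
  nlinarith [japaneseBracket_sq a, japaneseBracket_sq b]

theorem norm_sub_sq_le_convexityGap (a b : E) :
    ‖a - b‖ ^ 2 ≤ convexityGap a b * (japaneseBracket a + japaneseBracket b) ^ 3 := by
  have hγ := convexityGap_nonneg a b
  have hm := japaneseBracket_sq ((1 / 2 : ℝ) • a + (1 / 2 : ℝ) • b)
  have hm1 := one_le_japaneseBracket ((1 / 2 : ℝ) • a + (1 / 2 : ℝ) • b)
  have hγe : convexityGap a b = (japaneseBracket a + japaneseBracket b) / 2 -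
    japaneseBracket ((1 / 2 : ℝ) • a + (1 / 2 : ℝ) • b) := rfl
  rw [norm_midpoint_sq] at hm
  have ha := one_le_japaneseBracket a
  have hb := one_le_japaneseBracket b
  have hα := japaneseBracket_sq a
  have hβ := japaneseBracket_sq b
  have h := one_add_inner_le a b
  have hcs := abs_real_inner_le_norm a b
  have hcs2 := sq_le_sq' (by linarith [neg_abs_le (inner ℝ a b)]) ((le_abs_self _).trans hcs)
  have hsub := norm_sub_sq_real a b
  set α := japaneseBracket a
  set β := japaneseBracket b
  set m := japaneseBracket ((1 / 2 : ℝ) • a + (1 / 2 : ℝ) • b)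
  set γ := convexityGap a b
  set p := inner ℝ a b
  have hp := le_abs_self (1 + p)
  have e1 : γ * ((α + β) / 2 + m) = (α * β - 1 - p) / 2 := by rw [hγe]; nlinarith
  have e2 : (α * β - 1 - p) / 2 ≤ γ * (α + β) := by
    rw [← e1]; exact mul_le_mul_of_nonneg_left (by linarith) hγ
  have e3 : ‖a - b‖ ^ 2 ≤ (α * β - 1 - p) * (α * β + 1 + p) := by
    have : (α * β) ^ 2 = (1 + ‖a‖ ^ 2) * (1 + ‖b‖ ^ 2) := by rw [mul_pow, hα, hβ]
    nlinarith
  have hab : 0 ≤ α * β := by positivity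
  have e4 : (α * β - 1 - p) * (α * β + 1 + p) ≤ (2 * (γ * (α + β))) * (2 * (α * β)) := by
    refine (mul_le_mul_of_nonneg_left (by linarith : α * β + 1 + p ≤ 2 * (α * β))
      (by linarith)).trans (mul_le_mul_of_nonneg_right (by linarith) (by linarith))
  have e5 : 4 * (α * β) ≤ (α + β) ^ 2 := by nlinarith [sq_nonneg (α - β)]
  have e6 := mul_le_mul_of_nonneg_left e5 (mul_nonneg hγ (by linarith : 0 ≤ α + β))
  nlinarith

theorem min_one_norm_sub_le (a b : E) {t : ℝ} (ht : 0 < t) :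
    min 1 ‖a - b‖ ≤ convexityGap a b / t ^ 3 + t * (japaneseBracket a + japaneseBracket b) := by
  have hγ := convexityGap_nonneg a b
  have ha := one_le_japaneseBracket a
  have hb := one_le_japaneseBracket b
  have h := norm_sub_sq_le_convexityGap a b
  set X := convexityGap a b / t ^ 3
  set Y := t * (japaneseBracket a + japaneseBracket b)
  have hX : 0 ≤ X := by positivity
  have hY : 0 ≤ Y := by positivity
  have e : convexityGap a b * (japaneseBracket a + japaneseBracket b) ^ 3 = X * Y ^ 3 := by
    simp only [X, Y]; field_simp
  rw [e] at h
  have h2 : X * Y ^ 3 ≤ (X + Y) * (X + Y) ^ 3 := by gcongr <;> linarith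
  have h3 : ‖a - b‖ ≤ (X + Y) ^ 2 := by
    apply le_of_sq_le_sq _ (by positivity)
    nlinarith
  rcases le_total 1 (X + Y) with h4 | h4
  · exact (min_le_left _ _).trans h4
  · exact (min_le_right _ _).trans (h3.trans (by nlinarith))

end gap

/-- Midpoint-convex decreasing families of functions bounded in `L¹` contain almost everywhere
convergent diagonal sequences. -/
theorem exists_ae_tendsto_of_midpoint_convex {α E : Type*} [MeasurableSpace α]
    [NormedAddCommGroup E] [InnerProductSpace ℝ E] [CompleteSpace E]
    {μ : Measure α} {S : ℕ → Set (α → E)} (hS : Antitone S) (hne : ∀ k, (S k).Nonempty)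
    (hmid : ∀ k, ∀ f ∈ S k, ∀ g ∈ S k,
      (fun x => (1 / 2 : ℝ) • f x + (1 / 2 : ℝ) • g x) ∈ S k)
    (hmeas : ∀ f ∈ S 0, AEStronglyMeasurable f μ) {B : ℝ≥0∞} (hB : B ≠ ⊤)
    (hbd : ∀ f ∈ S 0, ∫⁻ x, ENNReal.ofReal (japaneseBracket (f x)) ∂μ ≤ B) :
    ∃ (g : ℕ → α → E) (G : α → E), (∀ k, g k ∈ S k) ∧
      ∀ᵐ x ∂μ, Tendsto (fun k => g k x) atTop (𝓝 (G x)) := by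
  set J : (α → E) → ℝ≥0∞ := fun f => ∫⁻ x, ENNReal.ofReal (japaneseBracket (f x)) ∂μ with hJ
  set I : ℕ → ℝ≥0∞ := fun k => ⨅ f ∈ S k, J f with hI
  have hS0 : ∀ k, S k ⊆ S 0 := fun k => hS (Nat.zero_le k)
  have hImono : Monotone I := fun k l hkl => biInf_mono (hS hkl)
  have hIB : ∀ k, I k ≤ B := fun k => by
    obtain ⟨f, hf⟩ := hne k
    exact (biInf_le _ hf).trans (hbd f (hS0 k hf))
  have hIs : ⨆ k, I k ≠ ⊤ := ((iSup_le hIB).trans_lt hB.lt_top).ne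
  set ε : ℕ → ℝ≥0∞ := fun j => ENNReal.ofReal ((1 / 16) ^ j) with hε
  have hεpos : ∀ j, ε j ≠ 0 := fun j => by simp [hε]
  have hev : ∀ j, ∀ᶠ k in atTop, ⨆ k, I k ≤ I k + ε j := fun j => by
    have h1 : Tendsto (fun k => I k + ε j) atTop (𝓝 ((⨆ k, I k) + ε j)) :=
      (tendsto_atTop_iSup hImono).add_const _
    exact (h1.eventually (lt_mem_nhds (ENNReal.lt_add_right hIs (hεpos j)))).mono
      fun k hk => hk.le
  obtain ⟨K, hK, hKI⟩ := extraction_forall_of_eventually hev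
  have hex : ∀ j, ∃ f ∈ S (K j), J f ≤ (⨆ k, I k) + ε j := fun j => by
    have h1 : I (K j) < (⨆ k, I k) + ε j :=
      (le_iSup I (K j)).trans_lt (ENNReal.lt_add_right hIs (hεpos j))
    obtain ⟨f, hf⟩ := iInf_lt_iff.1 h1
    obtain ⟨hf1, hf2⟩ := iInf_lt_iff.1 hf
    exact ⟨f, hf1, hf2.le⟩
  choose g hgS hgJ using hex
  have hgm : ∀ j, AEStronglyMeasurable (g j) μ := fun j => hmeas _ (hS0 _ (hgS j))
  have hbm : ∀ {f : α → E}, AEStronglyMeasurable f μ →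
      AEMeasurable (fun x => ENNReal.ofReal (japaneseBracket (f x))) μ := fun hf =>
    (continuous_japaneseBracket.comp_aestronglyMeasurable hf).aemeasurable.ennreal_ofReal
  have hgapm : ∀ j, AEMeasurable
      (fun x => ENNReal.ofReal (convexityGap (g j x) (g (j + 1) x))) μ := fun j => by
    refine AEMeasurable.ennreal_ofReal (AEStronglyMeasurable.aemeasurable ?_)
    unfold convexityGap
    have h1 := continuous_japaneseBracket.comp_aestronglyMeasurable (hgm j)
    have h2 := continuous_japaneseBracket.comp_aestronglyMeasurable (hgm (j + 1))
    have h3 := continuous_japaneseBracket.comp_aestronglyMeasurable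
      (((hgm j).const_smul (1 / 2 : ℝ)).add ((hgm (j + 1)).const_smul (1 / 2 : ℝ)))
    exact (((h1.add h2).div₀ aestronglyMeasurable_const).sub h3)
  have hgap : ∀ j, ∫⁻ x, ENNReal.ofReal (convexityGap (g j x) (g (j + 1) x)) ∂μ ≤ 2 * ε j :=
    fun j => by
    set m : α → E := fun x => (1 / 2 : ℝ) • g j x + (1 / 2 : ℝ) • g (j + 1) x with hm
    have hmS : m ∈ S (K j) := hmid _ _ (hgS j) _ (hS (hK.monotone (Nat.le_succ j)) (hgS (j + 1)))
    have h1 : I (K j) ≤ J m := biInf_le _ hmS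
    have h2 : J m + ∫⁻ x, ENNReal.ofReal (convexityGap (g j x) (g (j + 1) x)) ∂μ =
        2⁻¹ * (J (g j) + J (g (j + 1))) := by
      simp only [hJ]
      rw [← lintegral_add_right' _ (hgapm j), ← lintegral_add_right' _ (hbm (hgm (j + 1))),
        ← lintegral_const_mul' _ _ (by simp)]
      refine lintegral_congr fun x => ?_
      have p1 := one_le_japaneseBracket (g j x)
      have p2 := one_le_japaneseBracket (g (j + 1) x)
      have p3 := one_le_japaneseBracket (m x)
      rw [← ENNReal.ofReal_add (by linarith) (convexityGap_nonneg _ _),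
        ← ENNReal.ofReal_add (by linarith) (by linarith),
        show (2⁻¹ : ℝ≥0∞) = ENNReal.ofReal 2⁻¹ by
          rw [ENNReal.ofReal_inv_of_pos (by norm_num)]; simp,
        ← ENNReal.ofReal_mul (by norm_num)]
      congr 1
      simp only [convexityGap, hm]
      ring
    have hε1 : ε (j + 1) ≤ ε j := ENNReal.ofReal_le_ofReal
      (pow_le_pow_of_le_one (by norm_num) (by norm_num) (Nat.le_succ j))
    have h3 : 2⁻¹ * (J (g j) + J (g (j + 1))) ≤ (⨆ k, I k) + ε j := by
      have : J (g j) + J (g (j + 1)) ≤ 2 * ((⨆ k, I k) + ε j) := by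
        rw [two_mul]
        exact add_le_add (hgJ j) ((hgJ (j + 1)).trans (by gcongr))
      calc _ ≤ 2⁻¹ * (2 * ((⨆ k, I k) + ε j)) := by gcongr
        _ = _ := by rw [← mul_assoc, ENNReal.inv_mul_cancel (by simp) (by simp), one_mul]
    have h4 : (⨆ k, I k) + ∫⁻ x, ENNReal.ofReal (convexityGap (g j x) (g (j + 1) x)) ∂μ ≤
        (⨆ k, I k) + 2 * ε j := calc
      _ ≤ (J m + ε j) + ∫⁻ x, ENNReal.ofReal (convexityGap (g j x) (g (j + 1) x)) ∂μ := by
        gcongr; exact (hKI j).trans (by gcongr)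
      _ = (J m + ∫⁻ x, ENNReal.ofReal (convexityGap (g j x) (g (j + 1) x)) ∂μ) + ε j := by ring
      _ ≤ ((⨆ k, I k) + ε j) + ε j := by rw [h2]; gcongr
      _ = _ := by ring
    exact (ENNReal.add_le_add_iff_left hIs).1 h4
  have hdm : ∀ j, AEMeasurable
      (fun x => ENNReal.ofReal (min 1 ‖g j x - g (j + 1) x‖)) μ := fun j =>
    (aemeasurable_const.min ((hgm j).sub (hgm (j + 1))).norm.aemeasurable).ennreal_ofReal
  have hd : ∀ j, ∫⁻ x, ENNReal.ofReal (min 1 ‖g j x - g (j + 1) x‖) ∂μ ≤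
      ENNReal.ofReal ((1 / 2) ^ j) * (2 + 2 * B) := fun j => by
    have ht : (0 : ℝ) < (1 / 2) ^ j := by positivity
    calc _ ≤ ∫⁻ x, (ENNReal.ofReal (8 ^ j) *
            ENNReal.ofReal (convexityGap (g j x) (g (j + 1) x)) +
          ENNReal.ofReal ((1 / 2) ^ j) * (ENNReal.ofReal (japaneseBracket (g j x)) +
            ENNReal.ofReal (japaneseBracket (g (j + 1) x)))) ∂μ := by
          refine lintegral_mono fun x => ?_
          have p1 := one_le_japaneseBracket (g j x)
          have p2 := one_le_japaneseBracket (g (j + 1) x)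
          have p3 := convexityGap_nonneg (g j x) (g (j + 1) x)
          rw [← ENNReal.ofReal_add (by linarith) (by linarith),
            ← ENNReal.ofReal_mul (by positivity), ← ENNReal.ofReal_mul (by positivity),
            ← ENNReal.ofReal_add (by positivity) (by positivity)]
          refine ENNReal.ofReal_le_ofReal ((min_one_norm_sub_le _ _ ht).trans (le_of_eq ?_))
          congr 1
          have : ((1 / 2 : ℝ) ^ j) ^ 3 * 8 ^ j = 1 := by
            rw [← pow_mul, mul_comm j 3, pow_mul, ← mul_pow]; norm_num
          field_simp
          linear_combination (-convexityGap (g j x) (g (j + 1) x)) * this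
      _ = ENNReal.ofReal (8 ^ j) *
            (∫⁻ x, ENNReal.ofReal (convexityGap (g j x) (g (j + 1) x)) ∂μ) +
          ENNReal.ofReal ((1 / 2) ^ j) * (J (g j) + J (g (j + 1))) := by
          rw [lintegral_add_left' ((hgapm j).const_mul _), lintegral_const_mul' _ _ (by simp),
            lintegral_const_mul' _ _ (by simp), lintegral_add_left' (hbm (hgm j))]
      _ ≤ ENNReal.ofReal (8 ^ j) * (2 * ε j) + ENNReal.ofReal ((1 / 2) ^ j) * (B + B) := by
          gcongr
          · exact hgap j
          · exact hbd _ (hS0 _ (hgS j))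
          · exact hbd _ (hS0 _ (hgS (j + 1)))
      _ = _ := by
          have : ENNReal.ofReal (8 ^ j) * ε j = ENNReal.ofReal ((1 / 2) ^ j) := by
            rw [hε, ← ENNReal.ofReal_mul (by positivity), ← mul_pow]; norm_num
          rw [mul_left_comm, this]
          ring
  have hsum : ∫⁻ x, ∑' j, ENNReal.ofReal (min 1 ‖g j x - g (j + 1) x‖) ∂μ ≠ ⊤ := by
    rw [lintegral_tsum hdm]
    refine ((ENNReal.tsum_le_tsum hd).trans_lt ?_).ne
    rw [ENNReal.tsum_mul_right]
    refine ENNReal.mul_lt_top ?_ ?_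
    · have hs : Summable fun j : ℕ => (1 / 2 : ℝ) ^ j :=
        summable_geometric_of_lt_one (by norm_num) (by norm_num)
      rw [← ENNReal.ofReal_tsum_of_nonneg (fun j => by positivity) hs]
      exact ENNReal.ofReal_lt_top
    · exact ENNReal.add_lt_top.2 ⟨by simp, ENNReal.mul_lt_top (by simp) hB.lt_top⟩
  have hlim : ∀ᵐ x ∂μ, ∃ y, Tendsto (fun k => g k x) atTop (𝓝 y) := by
    filter_upwards [ae_lt_top' (AEMeasurable.tsum hdm) hsum] with x hx
    have hs : Summable fun j => min 1 ‖g j x - g (j + 1) x‖ := by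
      have := ENNReal.summable_toReal hx.ne
      refine this.congr fun j => ?_
      rw [ENNReal.toReal_ofReal (le_min zero_le_one (norm_nonneg _))]
    have hev : ∀ᶠ j in atTop, min 1 ‖g j x - g (j + 1) x‖ = dist (g j x) (g (j + 1) x) := by
      filter_upwards [hs.tendsto_atTop_zero.eventually (gt_mem_nhds zero_lt_one)] with j hj
      rw [dist_eq_norm]
      apply min_eq_right
      by_contra hc
      rw [min_eq_left (not_le.1 hc).le] at hj
      exact lt_irrefl _ hj
    exact cauchySeq_tendsto_of_complete (cauchySeq_of_summable_dist (hs.congr_atTop hev))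
  refine ⟨g, fun x => limUnder atTop fun k => g k x, fun k => hS (hK.le_apply) (hgS k), ?_⟩
  filter_upwards [hlim] with x hx
  exact tendsto_nhds_limUnder hx

theorem LocallyCoercive.exists_enorm_le {n : ℕ} {Ψ : En n → En n → ℝ≥0∞}
    (h : LocallyCoercive Ψ) {K : Set (En n)} (hK : IsCompact K) (N : ℕ) :
    ∃ r : ℝ, ∀ x ∈ K, ∀ ξ : En n, N * ‖ξ‖ₑ ≤ N * ENNReal.ofReal r + Ψ x ξ := by
  obtain ⟨r, hr⟩ := h K hK N
  refine ⟨r, fun x hx ξ => ?_⟩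
  rcases le_total r ‖ξ‖ with h1 | h1
  · refine le_add_left ?_
    have := hr x hx ξ h1
    rwa [ENNReal.ofReal_mul (Nat.cast_nonneg N), ENNReal.ofReal_natCast, ofReal_norm] at this
  · refine le_add_right ?_
    gcongr
    rw [← ofReal_norm]
    exact ENNReal.ofReal_le_ofReal h1

theorem aemeasurable_integrand {n : ℕ} {Ψ : En n → En n → ℝ≥0∞}
    (hΨ : Measurable (Function.uncurry Ψ)) {G : En n → En n} {μ : Measure (En n)}
    (hG : AEStronglyMeasurable G μ) : AEMeasurable (fun y => Ψ y (G y)) μ :=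
  hΨ.comp_aemeasurable (aemeasurable_id.prodMk hG.aemeasurable)

/-- Bounded superlinear energy upgrades almost everywhere convergence to convergence in `L¹` on
compact sets. -/
theorem LocallyCoercive.tendsto_lintegral_enorm_sub {n : ℕ} {Ψ : En n → En n → ℝ≥0∞}
    (h : LocallyCoercive Ψ) (hΨ : Measurable (Function.uncurry Ψ)) {K : Set (En n)}
    (hK : IsCompact K) {g : ℕ → En n → En n} {G : En n → En n}
    (hg : ∀ k, AEStronglyMeasurable (g k) volume)
    (hgG : ∀ᵐ x, Tendsto (fun k => g k x) atTop (𝓝 (G x))) {C : ℝ≥0∞} (hC : C ≠ ⊤)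
    (hgC : ∀ k, ∫⁻ x, Ψ x (g k x) ≤ C) (hGC : ∫⁻ x, Ψ x (G x) ≤ C) :
    Tendsto (fun k => ∫⁻ x in K, ‖g k x - G x‖ₑ) atTop (𝓝 0) := by
  have hG : AEStronglyMeasurable G volume := aestronglyMeasurable_of_tendsto_ae atTop hg hgG
  rw [ENNReal.tendsto_nhds_zero]
  intro ε hε
  obtain ⟨N, hN⟩ := ENNReal.exists_nat_mul_gt (ENNReal.half_pos hε.ne').ne'
    (ENNReal.add_ne_top.2 ⟨hC, hC⟩)
  have hN0 : (N : ℝ≥0∞) ≠ 0 := by rintro h0; simp [h0] at hN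
  obtain ⟨r, hr⟩ := h.exists_enorm_le hK N
  have hpt : ∀ k, ∀ x ∈ K, N * ‖g k x - G x‖ₑ ≤
      N * min ‖g k x - G x‖ₑ (2 * ENNReal.ofReal r) + (Ψ x (g k x) + Ψ x (G x)) := by
    intro k x hx
    rcases le_total ‖g k x - G x‖ₑ (2 * ENNReal.ofReal r) with h1 | h1
    · rw [min_eq_left h1]; exact le_self_add
    · rw [min_eq_right h1]
      calc N * ‖g k x - G x‖ₑ ≤ N * (‖g k x‖ₑ + ‖G x‖ₑ) := by gcongr; exact enorm_sub_le
        _ ≤ (N * ENNReal.ofReal r + Ψ x (g k x)) + (N * ENNReal.ofReal r + Ψ x (G x)) := by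
          rw [mul_add]; exact add_le_add (hr x hx _) (hr x hx _)
        _ = _ := by ring
  have hmin : Tendsto (fun k => ∫⁻ x in K, min ‖g k x - G x‖ₑ (2 * ENNReal.ofReal r)) atTop
      (𝓝 (∫⁻ x in K, 0)) := by
    refine tendsto_lintegral_of_dominated_convergence' (fun _ => 2 * ENNReal.ofReal r)
      (fun k => ?_) (fun k => Eventually.of_forall fun x => min_le_right _ _) ?_ ?_
    · exact (((hg k).sub hG).restrict.enorm).min aemeasurable_const
    · rw [setLIntegral_const]
      exact ENNReal.mul_ne_top (ENNReal.mul_ne_top (by simp) (by simp)) hK.measure_lt_top.ne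
    · refine ae_restrict_of_ae (hgG.mono fun x hx => ?_)
      have h1 : Tendsto (fun k => ‖g k x - G x‖ₑ) atTop (𝓝 0) := by
        have := (hx.sub_const (G x)).enorm
        simpa using this
      have h2 := h1.min (tendsto_const_nhds (x := 2 * ENNReal.ofReal r))
      simpa using h2
  rw [lintegral_zero, ENNReal.tendsto_nhds_zero] at hmin
  filter_upwards [hmin (ε / 2) (ENNReal.half_pos hε.ne')] with k hk
  have hmeas : AEMeasurable (fun x => min ‖g k x - G x‖ₑ (2 * ENNReal.ofReal r))
    (volume.restrict K) := (((hg k).sub hG).restrict.enorm).min aemeasurable_const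
  have h1 : N * ∫⁻ x in K, ‖g k x - G x‖ₑ ≤ N * ε := calc
    _ = ∫⁻ x in K, N * ‖g k x - G x‖ₑ := (lintegral_const_mul' _ _ (by simp)).symm
    _ ≤ ∫⁻ x in K, (N * min ‖g k x - G x‖ₑ (2 * ENNReal.ofReal r) +
        (Ψ x (g k x) + Ψ x (G x))) :=
      setLIntegral_mono' hK.measurableSet (hpt k)
    _ = N * (∫⁻ x in K, min ‖g k x - G x‖ₑ (2 * ENNReal.ofReal r)) +
        ((∫⁻ x in K, Ψ x (g k x)) + ∫⁻ x in K, Ψ x (G x)) := by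
      rw [lintegral_add_left' (hmeas.const_mul _), lintegral_const_mul' _ _ (by simp),
        lintegral_add_left' (aemeasurable_integrand hΨ (hg k).restrict)]
    _ ≤ N * (ε / 2) + (C + C) := by
      gcongr
      · exact (setLIntegral_le_lintegral _ _).trans (hgC k)
      · exact (setLIntegral_le_lintegral _ _).trans hGC
    _ ≤ N * (ε / 2) + N * (ε / 2) := by gcongr
    _ = N * ε := by rw [← mul_add, ENNReal.add_halves]
  exact (ENNReal.mul_le_mul_iff_right hN0 (by simp)).1 h1

theorem LocallyCoercive.locallyIntegrable {n : ℕ} {Ψ : En n → En n → ℝ≥0∞}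
    (h : LocallyCoercive Ψ) {G : En n → En n} (hG : AEStronglyMeasurable G volume)
    (hfin : ∫⁻ x, Ψ x (G x) ≠ ⊤) : LocallyIntegrable G volume := by
  rw [locallyIntegrable_iff]
  intro K hK
  refine ⟨hG.restrict, ?_⟩
  obtain ⟨r, hr⟩ := h.exists_enorm_le hK 1
  calc ∫⁻ x in K, ‖G x‖ₑ ≤ ∫⁻ x in K, (ENNReal.ofReal r + Ψ x (G x)) :=
        setLIntegral_mono' hK.measurableSet fun x hx => by simpa using hr x hx (G x)
    _ = ENNReal.ofReal r * volume K + ∫⁻ x in K, Ψ x (G x) := by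
        rw [lintegral_add_left measurable_const, setLIntegral_const]
    _ < ⊤ := ENNReal.add_lt_top.2 ⟨ENNReal.mul_lt_top (by simp) hK.measure_lt_top,
        (setLIntegral_le_lintegral _ _).trans_lt hfin.lt_top⟩

/-- Bounded energy controls a weighted `L¹` norm, for a suitable positive weight. -/
theorem LocallyCoercive.exists_weight {n : ℕ} {Ψ : En n → En n → ℝ≥0∞}
    (h : LocallyCoercive Ψ) : ∃ ω : En n → ℝ≥0∞, Measurable ω ∧ (∀ x, ω x ≠ 0) ∧
      ∀ G : En n → En n, AEStronglyMeasurable G volume →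
        ∫⁻ x, ENNReal.ofReal (japaneseBracket (G x)) ∂(volume.withDensity ω) ≤
          1 + ∫⁻ x, Ψ x (G x) := by
  choose r hr using fun m : ℕ =>
    h.exists_enorm_le (isCompact_closedBall (0 : En n) m) 1
  obtain ⟨p, hp, hpm, hp1⟩ := exists_pos_lintegral_lt_of_sigmaFinite
    (volume : Measure (En n)) one_ne_zero
  set ρ : En n → ℝ≥0∞ := fun x => 1 + ENNReal.ofReal (r ⌈‖x‖⌉₊) with hρ
  have hρm : Measurable ρ := measurable_const.add
    (((measurable_from_top (f := r)).comp (Nat.measurable_ceil.comp measurable_norm)).ennreal_ofReal)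
  have hρ0 : ∀ x, ρ x ≠ 0 := fun x => by simp [hρ]
  have hρt : ∀ x, ρ x ≠ ⊤ := fun x => by simp [hρ]
  refine ⟨fun x => min 1 (p x / ρ x), measurable_const.min
    (hpm.coe_nnreal_ennreal.div hρm), fun x => ?_, fun G hG => ?_⟩
  · refine (lt_min one_pos (ENNReal.div_pos ?_ (hρt x))).ne'
    exact_mod_cast (hp x).ne'
  · have hω : Measurable fun x => min 1 (p x / ρ x) :=
      measurable_const.min (hpm.coe_nnreal_ennreal.div hρm)
    rw [lintegral_withDensity_eq_lintegral_mul_non_measurable _ hω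
      (Eventually.of_forall fun x => (min_le_left _ _).trans_lt one_lt_top)]
    calc _ ≤ ∫⁻ x, ((p x : ℝ≥0∞) + Ψ x (G x)) := by
          refine lintegral_mono fun x => ?_
          have h1 : ENNReal.ofReal (japaneseBracket (G x)) ≤ ρ x + Ψ x (G x) := by
            refine (ENNReal.ofReal_le_ofReal (japaneseBracket_le _)).trans ?_
            rw [ENNReal.ofReal_add zero_le_one (norm_nonneg _), ofReal_norm,
              ENNReal.ofReal_one, hρ, add_assoc]
            gcongr
            have := hr ⌈‖x‖⌉₊ x (by simpa using Nat.le_ceil ‖x‖) (G x)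
            simpa using this
          calc min 1 (p x / ρ x) * ENNReal.ofReal (japaneseBracket (G x))
              ≤ min 1 (p x / ρ x) * ρ x + min 1 (p x / ρ x) * Ψ x (G x) := by
                rw [← mul_add]; gcongr
            _ ≤ p x / ρ x * ρ x + 1 * Ψ x (G x) := by
                gcongr
                · exact min_le_right _ _
                · exact min_le_left _ _
            _ = _ := by rw [ENNReal.div_mul_cancel (hρ0 x) (hρt x), one_mul]
      _ = (∫⁻ x, (p x : ℝ≥0∞)) + ∫⁻ x, Ψ x (G x) :=
          lintegral_add_left hpm.coe_nnreal_ennreal _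
      _ ≤ _ := by gcongr

theorem tendsto_setIntegral_abs_sub_of_le {n : ℕ} {w : ℕ → En n → ℝ} {v : En n → ℝ}
    (hw : ∀ k, LocallyIntegrable (w k) volume) (hv : LocallyIntegrable v volume) {ε : ℕ → ℝ}
    (hε : Tendsto ε atTop (𝓝 0)) (h : ∀ k x, |w k x - v x| ≤ ε k) {K : Set (En n)}
    (hK : IsCompact K) : Tendsto (fun k => ∫ x in K, |w k x - v x|) atTop (𝓝 0) := by
  refine squeeze_zero (g := fun k => ε k * volume.real K)
    (fun k => integral_nonneg fun x => abs_nonneg _) (fun k => ?_) ?_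
  · have hfin : IsFiniteMeasure (volume.restrict K) := ⟨by simpa using hK.measure_lt_top⟩
    calc _ ≤ ∫ x in K, ε k := integral_mono
          (((hw k).sub hv).integrableOn_isCompact hK).abs (integrable_const _) (h k)
      _ = _ := by rw [setIntegral_const, smul_eq_mul, mul_comm]
  · simpa using hε.mul_const (volume.real K)

/-- Closure of the energy sublevel sets under uniform approximation. -/
theorem exists_hasWeakGradient_of_approx {n : ℕ} {Ψ : En n → En n → ℝ≥0∞}
    (hΨmeas : Measurable (Function.uncurry Ψ)) (hcoercive : LocallyCoercive Ψ)
    (hconv : ∀ (y : En n) (ξ η : En n) (a b : ℝ), 0 ≤ a → 0 ≤ b → a + b = 1 →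
      Ψ y (a • ξ + b • η) ≤ ENNReal.ofReal a * Ψ y ξ + ENNReal.ofReal b * Ψ y η)
    (hlsc : ∀ y : En n, LowerSemicontinuous (Ψ y))
    {v : En n → ℝ} (hv : LocallyIntegrable v volume) {C : ℝ≥0∞} (hC : C ≠ ⊤)
    (happ : ∀ ε : ℝ, 0 < ε → ∃ (w : En n → ℝ) (G : En n → En n), HasWeakGradient w G ∧
      (∀ y, |w y - v y| ≤ ε) ∧ ∫⁻ y, Ψ y (G y) ≤ C + ENNReal.ofReal ε) :
    ∃ G : En n → En n, HasWeakGradient v G ∧ ∫⁻ y, Ψ y (G y) ≤ C := by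
  set ε : ℕ → ℝ := fun k => 1 / ((k : ℝ) + 1) with hε
  have hε0 : Tendsto ε atTop (𝓝 0) := tendsto_one_div_add_atTop_nhds_zero_nat
  have hεanti : Antitone ε := fun k l hkl => Nat.one_div_le_one_div hkl
  have hε1 : ∀ k, ε k ≤ 1 := fun k => by simpa [hε] using hεanti (Nat.zero_le k)
  set S : ℕ → Set (En n → En n) := fun k => {G | ∃ w : En n → ℝ, HasWeakGradient w G ∧
    (∀ y, |w y - v y| ≤ ε k) ∧ ∫⁻ y, Ψ y (G y) ≤ C + ENNReal.ofReal (ε k)} with hS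
  have hSanti : Antitone S := by
    rintro k l hkl G ⟨w, h1, h2, h3⟩
    exact ⟨w, h1, fun y => (h2 y).trans (hεanti hkl),
      h3.trans (by gcongr; exact hεanti hkl)⟩
  obtain ⟨ω, hωm, hω0, hω⟩ := hcoercive.exists_weight
  have hmid : ∀ k, ∀ f ∈ S k, ∀ g ∈ S k,
      (fun x => (1 / 2 : ℝ) • f x + (1 / 2 : ℝ) • g x) ∈ S k := by
    rintro k f ⟨w, h1, h2, h3⟩ g ⟨z, k1, k2, k3⟩
    refine ⟨_, (h1.const_mul (1 / 2)).add (k1.const_mul (1 / 2)), fun y => ?_, ?_⟩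
    · have e1 := abs_le.1 (h2 y)
      have e2 := abs_le.1 (k2 y)
      exact abs_le.2 ⟨by linarith, by linarith⟩
    · calc _ ≤ ∫⁻ y, (ENNReal.ofReal (1 / 2) * Ψ y (f y) + ENNReal.ofReal (1 / 2) * Ψ y (g y)) :=
            lintegral_mono fun y => hconv y _ _ _ _ (by norm_num) (by norm_num) (by norm_num)
        _ = ENNReal.ofReal (1 / 2) * (∫⁻ y, Ψ y (f y)) +
            ENNReal.ofReal (1 / 2) * ∫⁻ y, Ψ y (g y) := by
            rw [lintegral_add_left' ((aemeasurable_integrand hΨmeas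
              h1.2.1.aestronglyMeasurable).const_mul _), lintegral_const_mul' _ _ (by simp),
              lintegral_const_mul' _ _ (by simp)]
        _ ≤ ENNReal.ofReal (1 / 2) * (C + ENNReal.ofReal (ε k)) +
            ENNReal.ofReal (1 / 2) * (C + ENNReal.ofReal (ε k)) := by gcongr
        _ = _ := by
            rw [← add_mul, ← ENNReal.ofReal_add (by norm_num) (by norm_num)]
            norm_num
  obtain ⟨g, G, hgS, hgG⟩ := exists_ae_tendsto_of_midpoint_convex
    (μ := volume.withDensity ω) hSanti
    (fun k => by
      obtain ⟨w, G, h⟩ := happ (ε k) (by positivity)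
      exact ⟨G, w, h⟩) hmid
    (fun f hf => by
      obtain ⟨w, h1, -⟩ := hf
      exact h1.2.1.aestronglyMeasurable.mono_ac (withDensity_absolutelyContinuous _ _))
    (B := 1 + (C + 1)) (by simp [hC])
    (fun f hf => by
      obtain ⟨w, h1, -, h3⟩ := hf
      refine (hω f h1.2.1.aestronglyMeasurable).trans ?_
      gcongr
      simpa [hε] using h3)
  replace hgG : ∀ᵐ x, Tendsto (fun k => g k x) atTop (𝓝 (G x)) :=
    (withDensity_absolutelyContinuous' hωm.aemeasurable
      (Eventually.of_forall hω0)).ae_le hgG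
  choose w hw1 hw2 hw3 using hgS
  have hgm : ∀ k, AEStronglyMeasurable (g k) volume := fun k =>
    (hw1 k).2.1.aestronglyMeasurable
  have hGC : ∫⁻ y, Ψ y (G y) ≤ C := calc
    _ ≤ ∫⁻ y, liminf (fun k => Ψ y (g k y)) atTop := by
      refine lintegral_mono_ae (hgG.mono fun y hy => ?_)
      exact ((hlsc y).lowerSemicontinuousAt (G y)).le_liminf.trans
        (hy.liminf_le_liminf_comp)
    _ ≤ liminf (fun k => ∫⁻ y, Ψ y (g k y)) atTop :=
      lintegral_liminf_le' fun k => aemeasurable_integrand hΨmeas (hgm k)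
    _ ≤ liminf (fun k => C + ENNReal.ofReal (ε k)) atTop :=
      liminf_le_liminf (Eventually.of_forall hw3)
    _ = C := by
      have : Tendsto (fun k => C + ENNReal.ofReal (ε k)) atTop (𝓝 (C + ENNReal.ofReal 0)) :=
        (ENNReal.tendsto_ofReal hε0).const_add _
      simpa using this.liminf_eq
  have hGm : AEStronglyMeasurable G volume := aestronglyMeasurable_of_tendsto_ae atTop hgm hgG
  have hGl := hcoercive.locallyIntegrable hGm (hGC.trans_lt hC.lt_top).ne
  refine ⟨G, ⟨hv, hGl, fun φ hφ hs i => ?_⟩, hGC⟩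
  have hK : IsCompact (tsupport φ) := hs
  have hw := tendsto_integral_mul_of_tendsto_setIntegral_abs_sub (fun k => (hw1 k).1) hv
    (continuous_fderiv_apply_of_contDiff hφ (EuclideanSpace.single i 1))
    (hasCompactSupport_fderiv_apply hs _) hK
    (fun x hx => fderiv_apply_eq_zero_of_notMem_tsupport _ hx)
    (tendsto_setIntegral_abs_sub_of_le (fun k => (hw1 k).1) hv hε0 hw2 hK)
  have hL1 := hcoercive.tendsto_lintegral_enorm_sub hΨmeas hK hgm hgG (C := C + 1)
    (by simp [hC]) (fun k => (hw3 k).trans (by gcongr; simpa using hε1 k))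
    (hGC.trans le_self_add)
  have hg := tendsto_integral_mul_of_tendsto_setIntegral_abs_sub
    (fun k => (hw1 k).2.1.euclidean_apply i) (hGl.euclidean_apply i) hφ.continuous hs hK
    (fun x hx => image_eq_zero_of_notMem_tsupport hx) (by
      refine squeeze_zero' (Eventually.of_forall fun k => integral_nonneg fun x => abs_nonneg _)
        ?_ (ENNReal.tendsto_toReal (by simp) |>.comp hL1)
      filter_upwards [hL1.eventually (gt_mem_nhds one_pos)] with k hk
      have hm : AEStronglyMeasurable (fun x => g k x i - G x i) (volume.restrict (tsupport φ)) :=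
        (((hw1 k).2.1.euclidean_apply i).sub
          (hGl.euclidean_apply i)).aestronglyMeasurable.restrict
      rw [show (fun x => |g k x i - G x i|) = fun x => ‖g k x i - G x i‖ from rfl,
        integral_norm_eq_lintegral_enorm hm]
      refine ENNReal.toReal_mono (hk.trans one_lt_top).ne (lintegral_mono fun x => ?_)
      rw [← ofReal_norm, ← ofReal_norm]
      exact ENNReal.ofReal_le_ofReal (PiLp.norm_apply_le (g k x - G x) i))
  refine tendsto_nhds_unique hw ?_
  simp_rw [fun k => (hw1 k).2.2 φ hφ hs i]
  exact hg.neg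

theorem layer_of_le {a δ t : ℝ} (hδ : 0 ≤ δ) (h : t ≤ a) : layer a δ t = 0 := by
  rw [layer, max_eq_right (by linarith), max_eq_right (by linarith), sub_zero]

theorem layer_of_ge {a δ t : ℝ} (hδ : 0 ≤ δ) (h : a + δ ≤ t) : layer a δ t = δ := by
  rw [layer, max_eq_left (by linarith), max_eq_left (by linarith)]
  ring

theorem layer_mem_Icc {a δ : ℝ} (hδ : 0 ≤ δ) (t : ℝ) : layer a δ t ∈ Icc 0 δ := by
  simp only [layer, max_def, mem_Icc]
  split_ifs <;> constructor <;> linarith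

theorem layer_trunc {n : ℕ} (u : En n → ℝ) {K a δ : ℝ} (hδ : 0 ≤ δ) (ha : -K ≤ a)
    (hb : a + δ ≤ K) (x : En n) : layer a δ (trunc u K x) = layer a δ (u x) := by
  simp only [layer, trunc, max_def, min_def]
  split_ifs <;> linarith

theorem lintegral_indicator_integrand {n : ℕ} {Φ : En n → En n → ℝ≥0∞} (hΦ0 : ∀ x, Φ x 0 = 0)
    {s : Set (En n)} (G : En n → En n) (x : En n) :
    Φ x (s.indicator G x) = s.indicator (fun x => Φ x (G x)) x := by
  by_cases h : x ∈ s <;> simp [h, hΦ0]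

/-- The layers of a truncated Sobolev function are weakly differentiable. -/
theorem IsTruncGradient.exists_layer {n : ℕ} {u : En n → ℝ} {D : En n → En n}
    (hD : IsTruncGradient u D) {Φ : En n → En n → ℝ≥0∞} (hΦ0 : ∀ x, Φ x 0 = 0)
    {K a δ : ℝ} (hK : 0 ≤ K) (hδ : 0 ≤ δ) (ha : -K ≤ a) (hb : a + δ ≤ K) :
    ∃ E : En n → En n, HasWeakGradient (fun x => layer a δ (u x)) E ∧
      ∫⁻ x, Φ x (E x) ≤ ∫⁻ x in {x | a < u x ∧ u x < a + δ}, Φ x (D x) := by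
  obtain ⟨DK, hDK, hae⟩ := hD K hK
  refine ⟨_, by simpa only [layer_trunc u hδ ha hb] using hDK.layer a hδ, ?_⟩
  set s := {x | a < trunc u K x ∧ trunc u K x < a + δ}
  have hs : ∀ x ∈ s, (a < u x ∧ u x < a + δ) ∧ |u x| ≤ K := by
    rintro x ⟨h1, h2⟩
    simp only [trunc, lt_max_iff, max_lt_iff, lt_min_iff, min_lt_iff] at h1 h2
    have h3 : a < u x := by
      rcases h1 with h1 | h1
      · exact h1.1
      · linarith
    have h4 : u x < a + δ := by
      rcases h2.1 with h | h
      · exact h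
      · linarith
    exact ⟨⟨h3, h4⟩, abs_le.2 ⟨by linarith, by linarith⟩⟩
  have hsm : NullMeasurableSet s := by
    have := hDK.1.aestronglyMeasurable.aemeasurable
    exact (nullMeasurableSet_lt aemeasurable_const this).inter
      (nullMeasurableSet_lt this aemeasurable_const)
  calc ∫⁻ x, Φ x (s.indicator DK x) = ∫⁻ x in s, Φ x (DK x) := by
        simp_rw [lintegral_indicator_integrand hΦ0]
        exact lintegral_indicator₀ hsm _
    _ = ∫⁻ x in s, Φ x (D x) := by
        refine lintegral_congr_ae ?_
        filter_upwards [ae_restrict_of_ae hae, ae_restrict_mem₀ hsm] with x hx hxs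
        rw [hx (hs x hxs).2]
    _ ≤ _ := lintegral_mono_set fun x hx => (hs x hx).1

/-- A competitor for the capacity can be taken with values between `0` and the level. -/
theorem exists_of_capaGen_lt {n : ℕ} {Ψ : En n → En n → ℝ≥0∞} (hΨ0 : ∀ x, Ψ x 0 = 0)
    {δ : ℝ} (hδ : 0 ≤ δ) {A B : Set (En n)} {c : ℝ≥0∞} (h : capaGen Ψ δ A B < c) :
    ∃ (w : En n → ℝ) (g : En n → En n), HasWeakGradient w g ∧
      (∀ y ∈ A, w y = δ ∧ g y = 0) ∧ (∀ y ∉ B, w y = 0 ∧ g y = 0) ∧ (∀ y, w y ∈ Icc 0 δ) ∧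
      ∫⁻ y, Ψ y (g y) ≤ c := by
  simp only [capaGen, iInf_lt_iff] at h
  obtain ⟨w, g, hwg, hA, hB, hc⟩ := h
  refine ⟨_, _, hwg.layer 0 hδ, fun y hy => ?_, fun y hy => ?_, fun y => layer_mem_Icc hδ _, ?_⟩
  · exact ⟨layer_of_ge hδ (by rw [hA y hy, zero_add]),
      indicator_of_notMem (fun h => by simp [hA y hy] at h) _⟩
  · exact ⟨layer_of_le hδ (hB y hy).le, indicator_of_notMem (fun h => by simp [hB y hy] at h) _⟩
  · refine (lintegral_mono fun y => ?_).trans hc.le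
    rw [lintegral_indicator_integrand hΨ0]
    exact indicator_le_self _ _ y

/-- Glueing competitors for the capacities of successive layers. -/
theorem exists_glue {n : ℕ} {Ψ : En n → En n → ℝ≥0∞}
    (hΨmeas : Measurable (Function.uncurry Ψ)) (hΨ0 : ∀ y, Ψ y 0 = 0)
    {u : En n → ℝ} (hum : Measurable u) {f : En n → ℝ≥0∞} {U : En n → EReal} {K δ : ℝ}
    {v : En n → ℝ} (hv : ∀ y, max (min (U y) (K : EReal)) (-(K : EReal)) = (v y : EReal))
    {c : ℝ≥0∞} {N : ℕ} (hN : N * δ = 2 * K) (hK : 0 ≤ K) (hδ : 0 ≤ δ)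
    (hstep : ∀ a : ℝ, -K ≤ a → a + δ ≤ K → ∃ (w : En n → ℝ) (g : En n → En n),
      HasWeakGradient w g ∧ (∀ y, (a + δ : ℝ) < U y → w y = δ ∧ g y = 0) ∧
      (∀ y, U y ≤ a → w y = 0 ∧ g y = 0) ∧ (∀ y, w y ∈ Icc 0 δ) ∧
      ∫⁻ y, Ψ y (g y) ≤ (∫⁻ x in {x | a < u x ∧ u x < a + δ}, f x) + c) :
    ∃ (V : En n → ℝ) (G : En n → En n), HasWeakGradient V G ∧ (∀ y, |V y - v y| ≤ δ) ∧
      ∫⁻ y, Ψ y (G y) ≤ (∫⁻ x, f x) + N * c := by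
  have hvle : ∀ y (a : ℝ), -K ≤ a → U y ≤ a → v y ≤ a := fun y a ha h => by
    rw [← EReal.coe_le_coe_iff, ← hv]
    exact max_le ((min_le_left _ _).trans h) (by exact_mod_cast ha)
  have hvge : ∀ y (a : ℝ), a ≤ K → (a : EReal) < U y → a ≤ v y := fun y a ha h => by
    rw [← EReal.coe_le_coe_iff, ← hv]
    exact le_max_of_le_left (le_min h.le (by exact_mod_cast ha))
  have hvK : ∀ y, -K ≤ v y ∧ v y ≤ K := fun y => by
    rw [← EReal.coe_le_coe_iff, ← EReal.coe_le_coe_iff, ← hv, EReal.coe_neg]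
    exact ⟨le_max_right _ _, max_le (min_le_right _ _)
      (by rw [← EReal.coe_neg]; exact_mod_cast (by linarith : -K ≤ K))⟩
  have key : ∀ m : ℕ, m ≤ N → ∃ (V : En n → ℝ) (G : En n → En n), HasWeakGradient V G ∧
      (∀ y, ((-K + m * δ : ℝ) : EReal) < U y → V y = m * δ ∧ G y = 0) ∧
      (∀ y, U y ≤ ((-K + m * δ : ℝ) : EReal) → |V y - (v y + K)| ≤ δ) ∧
      ∫⁻ y, Ψ y (G y) ≤ (∫⁻ x in {x | u x < -K + m * δ}, f x) + m * c := by
    intro m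
    induction m with
    | zero =>
      intro _
      refine ⟨_, _, hasWeakGradient_zero, fun y _ => by simp, fun y hy => ?_, by simp [hΨ0]⟩
      have h1 := hvle y (-K) le_rfl (by simpa using hy)
      have h2 := (hvK y).1
      rw [abs_le]
      constructor <;> linarith
    | succ m ih =>
      intro hm
      obtain ⟨V, G, hVG, h1, h2, h3⟩ := ih (by omega)
      have hmN : ((m : ℝ) + 1) * δ ≤ 2 * K := by
        rw [← hN]
        have : (m : ℝ) + 1 ≤ N := by exact_mod_cast hm
        gcongr
      have hm0 : 0 ≤ (m : ℝ) * δ := by positivity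
      obtain ⟨w, g, hwg, k1, k2, k3, k4⟩ := hstep (-K + m * δ) (by linarith) (by linarith)
      have ea : -K + ((m + 1 : ℕ) : ℝ) * δ = -K + m * δ + δ := by push_cast; ring
      rw [ea]
      have hlt : ∀ y, ((-K + m * δ + δ : ℝ) : EReal) < U y →
          ((-K + m * δ : ℝ) : EReal) < U y := fun y hy =>
        lt_of_le_of_lt (by exact_mod_cast (by linarith)) hy
      refine ⟨_, _, hVG.add hwg, fun y hy => ?_, fun y hy => ?_, ?_⟩
      · rw [(h1 y (hlt y hy)).1, (h1 y (hlt y hy)).2, (k1 y hy).1, (k1 y hy).2]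
        refine ⟨by push_cast; ring, by simp⟩
      · rcases le_or_gt (U y) ((-K + m * δ : ℝ) : EReal) with h | h
        · rw [(k2 y h).1, add_zero]
          exact h2 y h
        · have e1 := hvge y _ (by linarith) h
          have e2 := hvle y _ (by linarith) hy
          have e3 := k3 y
          rw [(h1 y h).1, abs_le]
          constructor <;> linarith [e3.1, e3.2]
      · have hmeas : MeasurableSet {x | -K + m * δ < u x ∧ u x < -K + m * δ + δ} :=
          (measurableSet_lt measurable_const hum).inter (measurableSet_lt hum measurable_const)
        calc _ ≤ ∫⁻ y, (Ψ y (G y) + Ψ y (g y)) := by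
              refine lintegral_mono fun y => ?_
              rcases le_or_gt (U y) ((-K + m * δ : ℝ) : EReal) with h | h
              · simp [(k2 y h).2, hΨ0]
              · simp [(h1 y h).2, hΨ0]
          _ = (∫⁻ y, Ψ y (G y)) + ∫⁻ y, Ψ y (g y) :=
              lintegral_add_left' (aemeasurable_integrand hΨmeas
                hVG.2.1.aestronglyMeasurable) _
          _ ≤ ((∫⁻ x in {x | u x < -K + m * δ}, f x) + m * c) +
              ((∫⁻ x in {x | -K + m * δ < u x ∧ u x < -K + m * δ + δ}, f x) + c) :=
              add_le_add h3 k4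
          _ = ((∫⁻ x in {x | u x < -K + m * δ}, f x) +
              ∫⁻ x in {x | -K + m * δ < u x ∧ u x < -K + m * δ + δ}, f x) +
              ((m + 1 : ℕ) : ℝ≥0∞) * c := by push_cast; ring
          _ ≤ _ := by
              gcongr
              have hdisj : Disjoint {x | u x < -K + m * δ}
                  {x | -K + m * δ < u x ∧ u x < -K + m * δ + δ} :=
                Set.disjoint_left.2 fun x hx hx' => lt_asymm hx'.1 hx
              rw [← lintegral_union hmeas hdisj]
              refine lintegral_mono_set ?_
              rintro x (hx | hx)
              · have hx : u x < -K + m * δ := hx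
                show u x < -K + m * δ + δ
                linarith
              · exact hx.2
  obtain ⟨V, G, hVG, h1, h2, h3⟩ := key N le_rfl
  have eK : -K + N * δ = K := by linarith
  rw [eK] at h1 h2 h3
  refine ⟨_, _, hVG.sub_const K, fun y => ?_, h3.trans ?_⟩
  · rcases le_or_gt (U y) (K : EReal) with h | h
    · have := h2 y h
      rwa [show V y - K - v y = V y - (v y + K) by ring]
    · have e1 := hvge y K le_rfl h
      have e2 := (hvK y).2
      rw [(h1 y h).1, hN, show v y = K by linarith]
      simpa [show 2 * K - K - K = 0 by ring] using hδ
  · gcongr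
    exact Measure.restrict_le_self

/-- The Pólya–Szegő inequality for a truncation of the rearranged function. -/
theorem exists_hasWeakGradient_rearranged_trunc {n : ℕ} (R : SetRearrangement n)
    {Φ Ψ : En n → En n → ℝ≥0∞} (hΨmeas : Measurable (Function.uncurry Ψ))
    (hΦ0 : ∀ x, Φ x 0 = 0) (hΨ0 : ∀ y, Ψ y 0 = 0)
    (hcoercive : LocallyCoercive Ψ)
    (hconv : ∀ (y : En n) (ξ η : En n) (a b : ℝ), 0 ≤ a → 0 ≤ b → a + b = 1 →
      Ψ y (a • ξ + b • η) ≤ ENNReal.ofReal a * Ψ y ξ + ENNReal.ofReal b * Ψ y η)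
    (hlsc : ∀ y : En n, LowerSemicontinuous (Ψ y))
    (hcap : ∀ A B : Set (En n), MeasurableSet A → MeasurableSet B → A ⊆ B →
      ∀ lam : ℝ, 0 < lam →
        capaGen Ψ lam (R.setMap A) (R.setMap B) ≤ capaGen Φ lam A B)
    {u : En n → ℝ} (hum : Measurable u) {D : En n → En n} (hD : IsTruncGradient u D)
    (hfin : ∫⁻ x, Φ x (D x) < ⊤) {K : ℝ} (hK : 0 < K) {v : En n → ℝ}
    (hv : ∀ y, max (min (R.fnMap (fun x => (u x : EReal)) y) (K : EReal)) (-(K : EReal))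
      = (v y : EReal)) (hvl : LocallyIntegrable v volume) :
    ∃ G : En n → En n, HasWeakGradient v G ∧ ∫⁻ y, Ψ y (G y) ≤ ∫⁻ x, Φ x (D x) := by
  refine exists_hasWeakGradient_of_approx hΨmeas hcoercive hconv hlsc hvl hfin.ne
    fun ε hε => ?_
  obtain ⟨N, hN⟩ := exists_nat_gt (2 * K / ε)
  have hN0 : (0 : ℝ) < N := lt_trans (by positivity) hN
  have hδ : 0 < 2 * K / N := by positivity
  have hue : Measurable fun x => (u x : EReal) := hum.coe_real_ereal
  have hlev := R.levelSet_fnMap _ hue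
  obtain ⟨V, G, h1, h2, h3⟩ := exists_glue hΨmeas hΨ0 hum (f := fun x => Φ x (D x)) hv
    (c := ENNReal.ofReal (ε / N)) (N := N) (δ := 2 * K / N) (by field_simp) hK.le hδ.le
    fun a ha hb => by
      obtain ⟨E, hE, hEle⟩ := hD.exists_layer hΦ0 hK.le hδ.le ha hb
      have hms : ∀ t : ℝ, MeasurableSet {x | (t : EReal) < u x} := fun t =>
        measurableSet_lt measurable_const hue
      have hcapΦ : capaGen Φ (2 * K / N) {x | ((a + 2 * K / N : ℝ) : EReal) < u x}
          {x | (a : EReal) < u x} ≤ ∫⁻ x, Φ x (E x) :=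
        iInf₂_le_of_le _ _ (iInf₂_le_of_le hE
          (fun x hx => layer_of_ge hδ.le (EReal.coe_lt_coe_iff.1 hx).le)
          (iInf_le _ fun x hx => layer_of_le hδ.le
            (not_lt.1 fun h => hx (EReal.coe_lt_coe_iff.2 h))))
      have hlt := ((hcap _ _ (hms _) (hms a) (fun x hx => lt_of_le_of_lt
        (EReal.coe_le_coe_iff.2 (by linarith)) hx) _ hδ).trans (hcapΦ.trans hEle)).trans_lt
        (ENNReal.lt_add_right (b := ENNReal.ofReal (ε / N))
          ((setLIntegral_le_lintegral _ _).trans_lt hfin).ne (by simp; positivity))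
      rw [← hlev, ← hlev] at hlt
      obtain ⟨w, g, k1, k2, k3, k4, k5⟩ := exists_of_capaGen_lt hΨ0 hδ.le hlt
      exact ⟨w, g, k1, k2, fun y hy => k3 y (not_lt.2 hy), k4, k5⟩
  refine ⟨V, G, h1, fun y => (h2 y).trans ?_, h3.trans (le_of_eq ?_)⟩
  · rw [div_lt_iff₀ hε] at hN
    rw [div_le_iff₀ hN0]
    linarith
  · rw [← ENNReal.ofReal_natCast, ← ENNReal.ofReal_mul hN0.le]
    congr 2
    field_simp

/-- The real-valued truncation at level `K` of an extended real. -/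
def clip (K : ℝ) (t : EReal) : ℝ := (max (min t (K : EReal)) (-(K : EReal))).toReal

theorem coe_clip {K : ℝ} (hK : 0 ≤ K) (t : EReal) :
    max (min t (K : EReal)) (-(K : EReal)) = (clip K t : EReal) := by
  rw [clip, EReal.coe_toReal]
  · refine ne_top_of_le_ne_top (EReal.coe_ne_top K) (max_le (min_le_right _ _) ?_)
    rw [← EReal.coe_neg]
    exact_mod_cast (by linarith : -K ≤ K)
  · refine ne_bot_of_le_ne_bot (EReal.coe_ne_bot (-K)) ?_
    rw [EReal.coe_neg]
    exact le_max_right _ _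

theorem measurable_clip (K : ℝ) : Measurable (clip K) :=
  ((measurable_id.min measurable_const).max measurable_const).ereal_toReal

theorem clip_coe {K : ℝ} (hK : 0 ≤ K) (x : ℝ) : clip K x = max (min x K) (-K) := by
  rw [← EReal.coe_eq_coe_iff, ← coe_clip hK]
  norm_cast

theorem clip_top {K : ℝ} (hK : 0 ≤ K) : clip K ⊤ = K := by
  rw [← EReal.coe_eq_coe_iff, ← coe_clip hK, top_inf_eq, max_eq_left]
  rw [← EReal.coe_neg]
  exact_mod_cast (by linarith : -K ≤ K)

theorem clip_bot {K : ℝ} (hK : 0 ≤ K) : clip K ⊥ = -K := by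
  rw [← EReal.coe_eq_coe_iff, ← coe_clip hK, bot_inf_eq, max_eq_right bot_le, EReal.coe_neg]

theorem trunc_clip {n : ℕ} (U : En n → EReal) {K L : ℝ} (hK : 0 ≤ K) (hKL : K ≤ L) :
    trunc (fun y => clip L (U y)) K = fun y => clip K (U y) := by
  funext y
  simp only [trunc]
  induction U y with
  | bot => rw [clip_bot hK, clip_bot (hK.trans hKL), min_eq_left (by linarith),
      max_eq_right (by linarith)]
  | top => rw [clip_top hK, clip_top (hK.trans hKL), min_eq_right hKL,
      max_eq_left (by linarith)]
  | coe x =>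
    rw [clip_coe hK, clip_coe (hK.trans hKL)]
    simp only [max_def, min_def]
    split_ifs <;> linarith

theorem abs_clip_le {K : ℝ} (hK : 0 ≤ K) (t : EReal) : |clip K t| ≤ K := by
  induction t with
  | bot => rw [clip_bot hK, abs_neg, abs_of_nonneg hK]
  | top => rw [clip_top hK, abs_of_nonneg hK]
  | coe x =>
    rw [clip_coe hK, abs_le]
    exact ⟨le_max_right _ _, max_le (min_le_right _ _) (by linarith)⟩

theorem abs_clip_le_of_mem {K L : ℝ} (hK : 0 ≤ K) (hKL : K ≤ L) {t : EReal}
    (h1 : -(K : EReal) ≤ t) (h2 : t ≤ K) : |clip L t| ≤ K := by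
  have hL := hK.trans hKL
  rw [abs_le, ← EReal.coe_le_coe_iff, ← EReal.coe_le_coe_iff, ← coe_clip hL, EReal.coe_neg]
  refine ⟨le_max_of_le_left (le_min h1 ?_), max_le ((min_le_left _ _).trans h2) ?_⟩ <;>
  · rw [← EReal.coe_neg]
    exact_mod_cast (by linarith)

theorem locallyIntegrable_clip {n : ℕ} {U : En n → EReal} (hU : Measurable U) {K : ℝ}
    (hK : 0 ≤ K) : LocallyIntegrable (fun y => clip K (U y)) volume :=
  (locallyIntegrable_const K).mono ((measurable_clip K).comp hU).aestronglyMeasurable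
    (Eventually.of_forall fun y => by
      rw [Real.norm_eq_abs, Real.norm_of_nonneg hK]
      exact abs_clip_le hK _)

/-- Weak gradients of the truncations of an extended-real function patch together. -/
theorem exists_patched_gradient {n : ℕ} {U : En n → EReal} {Ψ : En n → En n → ℝ≥0∞}
    (hΨmeas : Measurable (Function.uncurry Ψ)) (hΨ0 : ∀ y, Ψ y 0 = 0) {C : ℝ≥0∞}
    (h : ∀ K : ℝ, 0 < K → ∃ G : En n → En n, HasWeakGradient (fun y => clip K (U y)) G ∧
      ∫⁻ y, Ψ y (G y) ≤ C) :
    ∃ Dstar : En n → En n, (∀ K : ℝ, 0 ≤ K → ∃ DK : En n → En n,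
      HasWeakGradient (fun y => clip K (U y)) DK ∧
      ∀ᵐ y, (-(K : EReal) ≤ U y ∧ U y ≤ (K : EReal)) → DK y = Dstar y) ∧
      ∫⁻ y, Ψ y (Dstar y) ≤ C := by
  classical
  choose G hG hGC using fun k : ℕ => h (k + 1) (by positivity)
  set P : ℕ → En n → Prop := fun k y =>
    -(((k : ℝ) + 1 : ℝ) : EReal) ≤ U y ∧ U y ≤ (((k : ℝ) + 1 : ℝ) : EReal) with hP
  have hPmono : ∀ y k l, k ≤ l → P k y → P l y := fun y k l hkl ⟨h1, h2⟩ => by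
    have h3 : (((k : ℝ) + 1 : ℝ) : EReal) ≤ (((l : ℝ) + 1 : ℝ) : EReal) :=
      EReal.coe_le_coe_iff.2 (by gcongr)
    exact ⟨(EReal.neg_le_neg_iff.2 h3).trans h1, h2.trans h3⟩
  have hcons : ∀ᵐ y, ∀ k l, k ≤ l → P k y → G k y = G l y := by
    rw [ae_all_iff]
    intro k
    rw [ae_all_iff]
    intro l
    by_cases hkl : k ≤ l
    · have hkl' : (k : ℝ) + 1 ≤ l + 1 := by gcongr
      have h1 := (hG l).trunc (K := k + 1) (by positivity)
      rw [trunc_clip U (by positivity) hkl'] at h1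
      filter_upwards [(hG k).ae_eq h1] with y hy _ hyP
      rw [hy, indicator_of_mem]
      exact abs_clip_le_of_mem (by positivity) hkl' hyP.1 hyP.2
    · exact Eventually.of_forall fun y hy => absurd hy hkl
  set Dstar : En n → En n := fun y => if hy : ∃ k, P k y then G (Nat.find hy) y else 0
    with hDstar
  have hDG : ∀ᵐ y, ∀ l, P l y → Dstar y = G l y := by
    filter_upwards [hcons] with y hy l hl
    have hex : ∃ k, P k y := ⟨l, hl⟩
    rw [hDstar]
    simp only [dif_pos hex]
    exact hy _ _ (Nat.find_min' hex hl) (Nat.find_spec hex)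
  refine ⟨Dstar, fun K hK => ?_, ?_⟩
  · have hKl : K ≤ (⌈K⌉₊ : ℝ) + 1 := (Nat.le_ceil K).trans (by linarith)
    have h1 := (hG ⌈K⌉₊).trunc hK
    rw [trunc_clip U hK hKl] at h1
    refine ⟨_, h1, ?_⟩
    filter_upwards [hDG] with y hy hyK
    rw [indicator_of_mem (show y ∈ {x | |clip (⌈K⌉₊ + 1) (U x)| ≤ K} from
      abs_clip_le_of_mem hK hKl hyK.1 hyK.2)]
    have h3 : (K : EReal) ≤ (((⌈K⌉₊ : ℝ) + 1 : ℝ) : EReal) := EReal.coe_le_coe_iff.2 hKl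
    exact (hy _ ⟨(EReal.neg_le_neg_iff.2 h3).trans hyK.1, hyK.2.trans h3⟩).symm
  · calc _ ≤ ∫⁻ y, liminf (fun k => Ψ y (G k y)) atTop := by
          refine lintegral_mono_ae (hDG.mono fun y hy => ?_)
          by_cases hex : ∃ k, P k y
          · obtain ⟨k, hk⟩ := hex
            refine le_liminf_of_le (by isBoundedDefault) ?_
            filter_upwards [eventually_ge_atTop k] with l hl
            rw [hy l (hPmono y k l hl hk)]
          · simp [hDstar, hex, hΨ0]
      _ ≤ liminf (fun k => ∫⁻ y, Ψ y (G k y)) atTop :=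
          lintegral_liminf_le' fun k =>
            aemeasurable_integrand hΨmeas (hG k).2.1.aestronglyMeasurable
      _ ≤ liminf (fun _ : ℕ => C) atTop := liminf_le_liminf (Eventually.of_forall hGC)
      _ = C := liminf_const C

end

/-- extension of the Pólya–Szegő inequality to truncated Sobolev
functions. -/
theorem statement17 {n : ℕ} (R : SetRearrangement n)
    (Φ Ψ : En n → En n → ℝ≥0∞)
    (hΦmeas : Measurable (Function.uncurry Φ)) (hΨmeas : Measurable (Function.uncurry Ψ))
    (hΦ0 : ∀ x, Φ x 0 = 0) (hΨ0 : ∀ y, Ψ y 0 = 0)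
    (hcoercive : LocallyCoercive Ψ)
    (hconv : ∀ (y : En n) (ξ η : En n) (a b : ℝ), 0 ≤ a → 0 ≤ b → a + b = 1 →
      Ψ y (a • ξ + b • η) ≤ ENNReal.ofReal a * Ψ y ξ + ENNReal.ofReal b * Ψ y η)
    (hlsc : ∀ y : En n, LowerSemicontinuous (Ψ y))
    (hcap : ∀ A B : Set (En n), MeasurableSet A → MeasurableSet B → A ⊆ B →
      ∀ lam : ℝ, 0 < lam →
        capaGen Ψ lam (R.setMap A) (R.setMap B) ≤ capaGen Φ lam A B)
    (u : En n → ℝ) (hum : Measurable u) (D : En n → En n)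
    (hD : IsTruncGradient u D)
    (hloc : ∀ K : ℝ, 0 ≤ K → ∃ v : En n → ℝ,
      (∀ y, R.fnMap (fun x => (trunc u K x : EReal)) y = (v y : EReal)) ∧
      LocallyIntegrable v volume)
    (hfin : ∫⁻ x, Φ x (D x) < ⊤) :
    ∃ Dstar : En n → En n,
      (∀ K : ℝ, 0 ≤ K → ∃ (vK : En n → ℝ) (DK : En n → En n),
        (∀ y, max (min (R.fnMap (fun x => (u x : EReal)) y) (K : EReal)) (-(K : EReal))
          = (vK y : EReal)) ∧
        HasWeakGradient vK DK ∧
        ∀ᵐ y ∂volume,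
          (-(K : EReal) ≤ R.fnMap (fun x => (u x : EReal)) y ∧
            R.fnMap (fun x => (u x : EReal)) y ≤ (K : EReal)) → DK y = Dstar y) ∧
      ∫⁻ y, Ψ y (Dstar y) ≤ ∫⁻ x, Φ x (D x) := by
  have hUm := R.measurable_fnMap _ hum.coe_real_ereal
  obtain ⟨Dstar, h1, h2⟩ := exists_patched_gradient
    (U := R.fnMap (fun x => (u x : EReal))) hΨmeas hΨ0 fun K hK =>
      exists_hasWeakGradient_rearranged_trunc R hΨmeas hΦ0 hΨ0 hcoercive hconv hlsc hcap hum hD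
        hfin hK (fun y => coe_clip hK.le _) (locallyIntegrable_clip hUm hK.le)
  refine ⟨Dstar, fun K hK => ?_, h2⟩
  obtain ⟨DK, h3, h4⟩ := h1 K hK
  exact ⟨_, DK, fun y => coe_clip hK _, h3, h4⟩
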